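/- Let α > 0 and let μ₀ be a probability measure on ℝ^d. If (μ_t)_{t∈[0,T]} and (ν_t)_{t∈[0,T]} are two solutions to the martingale problem (MP)^α_{μ₀} (possibly on different probability bases), then for every t ∈ [0,T] the random measures μ_t and ν_t have the same law; in particular, for every bounded continuous f : ℝ^d → ℝ, E[exp(−⟨μ_t, f⟩)] = E[exp(−⟨ν_t, f⟩)]. -/

import Mathlib

open MeasureTheory ProbabilityTheory Filter Set
open scoped ENNReal NNReal

noncomputable section

/-- Pairing `⟨μ, f⟩ = ∫ f dμ`. -/
def pairing {d : ℕ} (μ : ProbabilityMeasure (EuclideanSpace ℝ (Fin d)))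
    (f : EuclideanSpace ℝ (Fin d) → ℝ) : ℝ :=
  ∫ x, f x ∂(μ : Measure (EuclideanSpace ℝ (Fin d)))

/-- The Laplacian: sum of second partial derivatives. -/
def laplacian {d : ℕ} (φ : EuclideanSpace ℝ (Fin d) → ℝ) (x : EuclideanSpace ℝ (Fin d)) : ℝ :=
  ∑ i : Fin d,
    fderiv ℝ (fun y => fderiv ℝ φ y (EuclideanSpace.single i 1)) x (EuclideanSpace.single i 1)

/-- Squared norm of the gradient. -/
def gradSq {d : ℕ} (φ : EuclideanSpace ℝ (Fin d) → ℝ) (x : EuclideanSpace ℝ (Fin d)) : ℝ :=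
  ‖gradient φ x‖ ^ 2

/-- A real-valued process is a martingale on the time interval `[0, T]`
with respect to the filtration `ℱ` and measure `P`. -/
def MartingaleOn {Ω : Type*} {mΩ : MeasurableSpace Ω} (X : ℝ → Ω → ℝ)
    (ℱ : Filtration ℝ mΩ) (P : Measure Ω) (T : ℝ) : Prop :=
  (∀ t, 0 ≤ t → t ≤ T → StronglyMeasurable[ℱ t] (X t)) ∧
  ∀ s t, 0 ≤ s → s ≤ t → t ≤ T → P[X t | ℱ s] =ᵐ[P] X s

/-- Solution of the martingale problem `(MP)^α_{μ₀}` on `[0,T]`: an a.s. continuous,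
adapted probability-measure-valued process `μ` with `μ_0 = μ₀` such that for every
compactly supported smooth `φ`, the process
`M_t(φ) = ⟨μ_t, φ⟩ − ⟨μ₀, φ⟩ − (α/2)∫₀ᵗ ⟨μ_s, Δφ⟩ ds` is a martingale with
quadratic variation `∫₀ᵗ ⟨μ_s, ‖∇φ‖²⟩ ds`. -/
structure IsMPSolution (d : ℕ) (T α : ℝ) {Ω : Type*} [mΩ : MeasurableSpace Ω]
    (ℱ : Filtration ℝ mΩ) (P : Measure Ω)
    (μ0 : ProbabilityMeasure (EuclideanSpace ℝ (Fin d)))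
    (μ : ℝ → Ω → ProbabilityMeasure (EuclideanSpace ℝ (Fin d))) : Prop where
  init : ∀ᵐ ω ∂P, μ 0 ω = μ0
  cont : ∀ᵐ ω ∂P, ContinuousOn (fun t => μ t ω) (Set.Icc 0 T)
  mart : ∀ φ : EuclideanSpace ℝ (Fin d) → ℝ, ContDiff ℝ (⊤ : ℕ∞) φ → HasCompactSupport φ →
    MartingaleOn (fun t ω => pairing (μ t ω) φ - pairing μ0 φ
      - (α / 2) * ∫ s in (0:ℝ)..t, pairing (μ s ω) (laplacian φ)) ℱ P T
  qvar : ∀ φ : EuclideanSpace ℝ (Fin d) → ℝ, ContDiff ℝ (⊤ : ℕ∞) φ → HasCompactSupport φ →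
    MartingaleOn (fun t ω => (pairing (μ t ω) φ - pairing μ0 φ
      - (α / 2) * ∫ s in (0:ℝ)..t, pairing (μ s ω) (laplacian φ)) ^ 2
      - ∫ s in (0:ℝ)..t, pairing (μ s ω) (gradSq φ)) ℱ P T

/-- A bounded function that is strongly measurable with respect to `m`. -/
def BddMeas {Ω : Type*} (m : MeasurableSpace Ω) (Z : Ω → ℝ) : Prop :=
  StronglyMeasurable[m] Z ∧ ∃ C, ∀ ω, |Z ω| ≤ C

namespace BddMeas

variable {Ω : Type*} {m m' mΩ : MeasurableSpace Ω} {Z W : Ω → ℝ}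

theorem const (c : ℝ) : BddMeas m (fun _ : Ω => c) :=
  ⟨stronglyMeasurable_const, |c|, fun _ => le_rfl⟩

theorem mul (hZ : BddMeas m Z) (hW : BddMeas m W) : BddMeas m (fun ω => Z ω * W ω) := by
  obtain ⟨h1, C, hC⟩ := hZ
  obtain ⟨h2, D, hD⟩ := hW
  refine ⟨h1.mul h2, C * D, fun ω => ?_⟩
  rw [abs_mul]
  exact mul_le_mul (hC ω) (hD ω) (abs_nonneg _) ((abs_nonneg _).trans (hC ω))

theorem add (hZ : BddMeas m Z) (hW : BddMeas m W) : BddMeas m (fun ω => Z ω + W ω) := by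
  obtain ⟨h1, C, hC⟩ := hZ
  obtain ⟨h2, D, hD⟩ := hW
  exact ⟨h1.add h2, C + D, fun ω => (abs_add_le _ _).trans (add_le_add (hC ω) (hD ω))⟩

theorem sub (hZ : BddMeas m Z) (hW : BddMeas m W) : BddMeas m (fun ω => Z ω - W ω) := by
  obtain ⟨h1, C, hC⟩ := hZ
  obtain ⟨h2, D, hD⟩ := hW
  exact ⟨h1.sub h2, C + D, fun ω => (abs_sub _ _).trans (add_le_add (hC ω) (hD ω))⟩

theorem abs (hZ : BddMeas m Z) : BddMeas m (fun ω => |Z ω|) := by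
  obtain ⟨h1, C, hC⟩ := hZ
  exact ⟨h1.norm, C, fun ω => by simpa using hC ω⟩

theorem max (hZ : BddMeas m Z) (hW : BddMeas m W) : BddMeas m (fun ω => max (Z ω) (W ω)) := by
  obtain ⟨h1, C, hC⟩ := hZ
  obtain ⟨h2, D, hD⟩ := hW
  exact ⟨h1.sup h2, Max.max C D, fun ω => abs_max_le_max_abs_abs.trans (max_le_max (hC ω) (hD ω))⟩

theorem pow (hZ : BddMeas m Z) (n : ℕ) : BddMeas m (fun ω => Z ω ^ n) := by
  obtain ⟨h1, C, hC⟩ := hZ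
  refine ⟨h1.pow n, C ^ n, fun ω => ?_⟩
  rw [abs_pow]
  exact pow_le_pow_left₀ (abs_nonneg _) (hC ω) n

theorem sum {ι : Type*} {s : Finset ι} {f : ι → Ω → ℝ} (h : ∀ i ∈ s, BddMeas m (f i)) :
    BddMeas m (fun ω => ∑ i ∈ s, f i ω) := by
  classical
  induction s using Finset.induction_on with
  | empty => simpa using const 0
  | insert a s ha ih =>
    simp only [Finset.sum_insert ha]
    exact (h a (by simp)).add (ih fun i hi => h i (by simp [hi]))

theorem mono (hZ : BddMeas m Z) (h : m ≤ m') : BddMeas m' Z := ⟨hZ.1.mono h, hZ.2⟩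

theorem integrable {P : Measure[mΩ] Ω} [IsFiniteMeasure P] (hZ : BddMeas mΩ Z) :
    Integrable Z P := by
  obtain ⟨h1, C, hC⟩ := hZ
  exact Integrable.of_bound h1.aestronglyMeasurable C (ae_of_all _ hC)

end BddMeas

/-- The part of `∏ (y + δ)` that is linear in `δ`. -/
def listLin {I : Type*} (y δ : I → ℝ) : List I → ℝ
  | [] => 0
  | p :: L => δ p * (L.map y).prod + y p * listLin y δ L

/-- The part of `∏ (y + δ)` that is quadratic in `δ`. -/
def listQuad {I : Type*} (y δ : I → ℝ) : List I → ℝ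
  | [] => 0
  | p :: L => δ p * listLin y δ L + y p * listQuad y δ L

theorem list_sum_abs_nonneg {I : Type*} (δ : I → ℝ) (L : List I) :
    0 ≤ (L.map fun p => |δ p|).sum :=
  List.sum_nonneg (by simp only [List.mem_map]; rintro _ ⟨p, -, rfl⟩; exact abs_nonneg _)

theorem abs_list_prod_le {I : Type*} {y : I → ℝ} {B : ℝ} :
    ∀ {L : List I}, (∀ p ∈ L, |y p| ≤ B) → |(L.map y).prod| ≤ B ^ L.length
  | [], _ => by simp
  | p :: L, h => by
    have h1 := abs_list_prod_le (L := L) fun q hq => h q (by simp [hq])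
    have h2 := h p (by simp)
    simp only [List.map_cons, List.prod_cons, List.length_cons, abs_mul, pow_succ']
    exact mul_le_mul h2 h1 (abs_nonneg _) ((abs_nonneg _).trans h2)

theorem abs_listLin_le {I : Type*} {y δ : I → ℝ} {B : ℝ} (hB : 1 ≤ B) :
    ∀ {L : List I}, (∀ p ∈ L, |y p| ≤ B) →
      |listLin y δ L| ≤ B ^ L.length * (L.map fun p => |δ p|).sum
  | [], _ => by simp [listLin]
  | p :: L, h => by
    have h0 := abs_list_prod_le (L := L) fun q hq => h q (by simp [hq])
    have h1 := abs_listLin_le (δ := δ) hB (L := L) fun q hq => h q (by simp [hq])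
    have h2 := h p (by simp)
    have hs := list_sum_abs_nonneg δ L
    simp only [List.map_cons, List.sum_cons, List.length_cons, listLin]
    set σ := (L.map fun p => |δ p|).sum
    set b := B ^ L.length
    have hb : 0 ≤ b := by positivity
    calc |δ p * (L.map y).prod + y p * listLin y δ L|
        ≤ |δ p| * b + B * (b * σ) := by
          refine (abs_add_le _ _).trans ?_
          rw [abs_mul, abs_mul]
          gcongr
      _ ≤ |δ p| * (B * b) + B * (b * σ) := by
          gcongr
          nlinarith
      _ = B ^ (L.length + 1) * (|δ p| + σ) := by rw [pow_succ]; ring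

theorem abs_listQuad_le {I : Type*} {y δ : I → ℝ} {B : ℝ} (hB : 1 ≤ B) :
    ∀ {L : List I}, (∀ p ∈ L, |y p| ≤ B) →
      |listQuad y δ L| ≤ B ^ L.length * (L.map fun p => |δ p|).sum ^ 2
  | [], _ => by simp [listQuad]
  | p :: L, h => by
    have h0 := abs_listLin_le (δ := δ) hB (L := L) fun q hq => h q (by simp [hq])
    have h1 := abs_listQuad_le (δ := δ) hB (L := L) fun q hq => h q (by simp [hq])
    have h2 := h p (by simp)
    have hs := list_sum_abs_nonneg δ L
    simp only [List.map_cons, List.sum_cons, List.length_cons, listQuad]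
    set σ := (L.map fun p => |δ p|).sum
    set b := B ^ L.length
    have hb : 0 ≤ b := by positivity
    have hδ := abs_nonneg (δ p)
    calc |δ p * listLin y δ L + y p * listQuad y δ L|
        ≤ |δ p| * (b * σ) + B * (b * σ ^ 2) := by
          refine (abs_add_le _ _).trans ?_
          rw [abs_mul, abs_mul]
          gcongr
      _ ≤ |δ p| * (B * b * σ) + B * (b * σ ^ 2) := by
          gcongr
          nlinarith
      _ ≤ B * b * (|δ p| + σ) ^ 2 := by
          have : 0 ≤ B * b * (|δ p| * σ + |δ p| ^ 2) := by positivity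
          nlinarith
      _ = B ^ (L.length + 1) * (|δ p| + σ) ^ 2 := by rw [pow_succ]; ring

theorem abs_list_prod_add_sub_le {I : Type*} {y δ : I → ℝ} {B : ℝ} (hB : 1 ≤ B) :
    ∀ {L : List I}, (∀ p ∈ L, |y p| ≤ B) → (∀ p ∈ L, |y p + δ p| ≤ B) →
      |(L.map fun p => y p + δ p).prod - (L.map y).prod - listLin y δ L - listQuad y δ L|
        ≤ B ^ L.length * (L.map fun p => |δ p|).sum ^ 3
  | [], _, _ => by simp [listQuad, listLin]
  | p :: L, h, h' => by
    have h0 := abs_listQuad_le (δ := δ) hB (L := L) fun q hq => h q (by simp [hq])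
    have h1 := abs_list_prod_add_sub_le (δ := δ) hB (L := L) (fun q hq => h q (by simp [hq]))
      fun q hq => h' q (by simp [hq])
    have h2 := h' p (by simp)
    have hs := list_sum_abs_nonneg δ L
    simp only [List.map_cons, List.sum_cons, List.length_cons, List.prod_cons, listQuad, listLin]
    set σ := (L.map fun p => |δ p|).sum
    set b := B ^ L.length
    have hb : 0 ≤ b := by positivity
    have hδ := abs_nonneg (δ p)
    set R := (L.map fun p => y p + δ p).prod - (L.map y).prod - listLin y δ L - listQuad y δ L
      with hR
    calc _ = |δ p * listQuad y δ L + (y p + δ p) * R| := by rw [hR]; congr 1; ring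
      _ ≤ |δ p| * (b * σ ^ 2) + B * (b * σ ^ 3) := by
          refine (abs_add_le _ _).trans ?_
          rw [abs_mul, abs_mul]
          gcongr
      _ ≤ |δ p| * (B * b * σ ^ 2) + B * (b * σ ^ 3) := by
          gcongr
          nlinarith
      _ ≤ B * b * (|δ p| + σ) ^ 3 := by
          have : 0 ≤ B * b * (2 * |δ p| * σ ^ 2 + 3 * |δ p| ^ 2 * σ + |δ p| ^ 3) := by positivity
          nlinarith
      _ = B ^ (L.length + 1) * (|δ p| + σ) ^ 3 := by rw [pow_succ]; ring

/-- Running maximum of a sequence of functions. -/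
def runMax {Ω : Type*} (S : ℕ → Ω → ℝ) : ℕ → Ω → ℝ
  | 0 => fun _ => 0
  | n + 1 => fun ω => max (runMax S n ω) (S n ω)

theorem runMax_nonneg {Ω : Type*} (S : ℕ → Ω → ℝ) (ω : Ω) : ∀ n, 0 ≤ runMax S n ω
  | 0 => le_rfl
  | n + 1 => (runMax_nonneg S ω n).trans (le_max_left _ _)

theorem le_runMax {Ω : Type*} (S : ℕ → Ω → ℝ) (ω : Ω) :
    ∀ {n k : ℕ}, k < n → S k ω ≤ runMax S n ω
  | n + 1, k, h => by
    rcases Nat.lt_succ_iff_lt_or_eq.mp h with h | rfl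
    · exact (le_runMax S ω h).trans (le_max_left _ _)
    · exact le_max_right _ _

theorem runMax_le {Ω : Type*} {S : ℕ → Ω → ℝ} {ω : Ω} {c : ℝ} (hc : 0 ≤ c) :
    ∀ {n : ℕ}, (∀ k < n, S k ω ≤ c) → runMax S n ω ≤ c
  | 0, _ => hc
  | n + 1, h => max_le (runMax_le hc fun k hk => h k (by omega)) (h n (by omega))

theorem BddMeas.runMax {Ω : Type*} {m : MeasurableSpace Ω} {S : ℕ → Ω → ℝ} :
    ∀ {n : ℕ}, (∀ k < n, BddMeas m (S k)) → BddMeas m (runMax S n)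
  | 0, _ => BddMeas.const 0
  | n + 1, h => (BddMeas.runMax fun k hk => h k (by omega)).max (h n (by omega))

/-- If the total squares of a triangular array are bounded in `L²` and the array is uniformly
small, then the total of the third moments vanishes in the limit. -/
theorem tendsto_sum_integral_cube {Ω : Type*} {mΩ : MeasurableSpace Ω} {P : Measure Ω}
    [IsFiniteMeasure P] {S : ℕ → ℕ → Ω → ℝ} {B K : ℝ} (hB : 0 ≤ B)
    (hS : ∀ N, ∀ k < N, BddMeas mΩ (S N k))
    (h0 : ∀ N, ∀ k < N, ∀ ω, 0 ≤ S N k ω) (h1 : ∀ N, ∀ k < N, ∀ ω, S N k ω ≤ B)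
    (hlim : ∀ ω, ∀ ε > 0, ∀ᶠ N in atTop, ∀ k < N, S N k ω ≤ ε)
    (hK : ∀ N, ∫ ω, (∑ k ∈ Finset.range N, S N k ω ^ 2) ^ 2 ∂P ≤ K) :
    Tendsto (fun N => ∑ k ∈ Finset.range N, ∫ ω, S N k ω ^ 3 ∂P) atTop (nhds 0) := by
  have hm : ∀ N, BddMeas mΩ (runMax (S N) N) := fun N => BddMeas.runMax (hS N)
  have hV : ∀ N, BddMeas mΩ (fun ω => ∑ k ∈ Finset.range N, S N k ω ^ 2) := fun N =>
    BddMeas.sum fun k hk => (hS N k (Finset.mem_range.mp hk)).pow 2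
  have hmlim : Tendsto (fun N => ∫ ω, runMax (S N) N ω ^ 2 ∂P) atTop (nhds 0) := by
    have : (0 : ℝ) = ∫ _ : Ω, (0 : ℝ) ∂P := by simp
    rw [this]
    refine tendsto_integral_of_dominated_convergence (fun _ => B ^ 2)
      (fun N => ((hm N).pow 2).1.aestronglyMeasurable) (integrable_const _) ?_ ?_
    · refine fun N => ae_of_all _ fun ω => ?_
      rw [Real.norm_eq_abs, abs_pow, abs_of_nonneg (runMax_nonneg _ _ _)]
      exact pow_le_pow_left₀ (runMax_nonneg _ _ _) (runMax_le hB fun k hk => h1 N k hk ω) 2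
    · refine ae_of_all _ fun ω => ?_
      have h : Tendsto (fun N => runMax (S N) N ω) atTop (nhds 0) := by
        rw [Metric.tendsto_atTop']
        intro ε hε
        obtain ⟨N, hN⟩ := eventually_atTop.mp (hlim ω (ε / 2) (by positivity))
        refine ⟨N, fun n hn => ?_⟩
        rw [Real.dist_eq, sub_zero, abs_of_nonneg (runMax_nonneg _ _ _)]
        exact (runMax_le (by positivity) (hN n hn.le)).trans_lt (by linarith)
      simpa using h.pow 2
  have hK0 : 0 ≤ K := (integral_nonneg fun ω => by positivity).trans (hK 0)
  have key : ∀ ε > 0, ∀ N, ∑ k ∈ Finset.range N, ∫ ω, S N k ω ^ 3 ∂P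
      ≤ (1 / ε) * ∫ ω, runMax (S N) N ω ^ 2 ∂P + ε * K := by
    intro ε hε N
    calc ∑ k ∈ Finset.range N, ∫ ω, S N k ω ^ 3 ∂P
        = ∫ ω, ∑ k ∈ Finset.range N, S N k ω ^ 3 ∂P :=
          (integral_finsetSum _ fun k hk =>
            ((hS N k (Finset.mem_range.mp hk)).pow 3).integrable).symm
      _ ≤ ∫ ω, ((1 / ε) * runMax (S N) N ω ^ 2
            + ε * (∑ k ∈ Finset.range N, S N k ω ^ 2) ^ 2) ∂P := by
          refine integral_mono
            (BddMeas.sum fun k hk => (hS N k (Finset.mem_range.mp hk)).pow 3).integrable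
            (((BddMeas.const _).mul ((hm N).pow 2)).add
              ((BddMeas.const _).mul ((hV N).pow 2))).integrable fun ω => ?_
          simp only
          have e1 : ∑ k ∈ Finset.range N, S N k ω ^ 3
              ≤ runMax (S N) N ω * ∑ k ∈ Finset.range N, S N k ω ^ 2 := by
            rw [Finset.mul_sum]
            refine Finset.sum_le_sum fun k hk => ?_
            rw [pow_succ' _ 2]
            exact mul_le_mul_of_nonneg_right (le_runMax _ _ (Finset.mem_range.mp hk))
              (by positivity)
          refine e1.trans ?_
          set x := runMax (S N) N ω
          set v := ∑ k ∈ Finset.range N, S N k ω ^ 2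
          have h2 : 0 ≤ (1 / ε) * (x - ε * v) ^ 2 + 0 := by positivity
          have h3 : (1 / ε) * (x - ε * v) ^ 2 = (1 / ε) * x ^ 2 - 2 * (x * v) + ε * v ^ 2 := by
            field_simp
            ring
          have h4 : 0 ≤ (1 / ε) * x ^ 2 + ε * v ^ 2 := by positivity
          linarith
      _ = (1 / ε) * ∫ ω, runMax (S N) N ω ^ 2 ∂P
            + ε * ∫ ω, (∑ k ∈ Finset.range N, S N k ω ^ 2) ^ 2 ∂P := by
          rw [integral_add ((BddMeas.const _).mul ((hm N).pow 2)).integrable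
            ((BddMeas.const _).mul ((hV N).pow 2)).integrable, integral_const_mul,
            integral_const_mul]
      _ ≤ _ := by gcongr; exact hK N
  rw [Metric.tendsto_atTop']
  intro η hη
  set ε := η / (2 * (K + 1)) with hεdef
  have hε : 0 < ε := by positivity
  obtain ⟨N, hN⟩ := Metric.tendsto_atTop'.mp hmlim (ε * (η / 2)) (by positivity)
  refine ⟨N, fun n hn => ?_⟩
  have h2 := hN n hn
  rw [Real.dist_eq, sub_zero] at h2 ⊢
  rw [abs_of_nonneg (Finset.sum_nonneg fun k hk => integral_nonneg fun ω =>
    pow_nonneg (h0 n k (Finset.mem_range.mp hk) ω) 3)]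
  refine (key ε hε n).trans_lt ?_
  have h3 : ∫ ω, runMax (S n) n ω ^ 2 ∂P < ε * (η / 2) := (le_abs_self _).trans_lt h2
  have h4 : (1 / ε) * ∫ ω, runMax (S n) n ω ^ 2 ∂P < η / 2 := by
    calc _ < (1 / ε) * (ε * (η / 2)) := by gcongr
      _ = η / 2 := by field_simp
  have h5 : ε * K ≤ η / 2 := by
    rw [hεdef, div_mul_eq_mul_div, div_le_div_iff₀ (by positivity) (by positivity)]
    nlinarith
  linarith

/-- A family of bounded continuous martingales on `[0, T]` whose brackets close up on the family:
the conditional increment of `Y p * Y q` is a combination of `Y (D p q)` and `Y (S p q)` with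
deterministic coefficients. -/
structure IsMomentSystem {I Ω : Type*} {mΩ : MeasurableSpace Ω} (P : Measure Ω) (T : ℝ)
    (𝒜 : Filtration ℝ mΩ) (D S : I → I → I) (a b : I → I → ℝ → ℝ → ℝ)
    (Y : I → ℝ → Ω → ℝ) : Prop where
  meas : ∀ p t, 0 ≤ t → t ≤ T → StronglyMeasurable[𝒜 t] (Y p t)
  bound : ∀ p, ∃ B, ∀ t, 0 ≤ t → t ≤ T → ∀ ω, |Y p t ω| ≤ B
  cont : ∀ p ω, ContinuousOn (fun t => Y p t ω) (Icc 0 T)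
  mart : ∀ p s t, 0 ≤ s → s ≤ t → t ≤ T → ∀ Z, BddMeas (𝒜 s) Z →
    ∫ ω, Z ω * Y p t ω ∂P = ∫ ω, Z ω * Y p s ω ∂P
  bracket : ∀ p q s t, 0 ≤ s → s ≤ t → t ≤ T → ∀ Z, BddMeas (𝒜 s) Z →
    ∫ ω, Z ω * (Y p t ω * Y q t ω) ∂P - ∫ ω, Z ω * (Y p s ω * Y q s ω) ∂P
      = a p q s t * ∫ ω, Z ω * Y (D p q) s ω ∂P + b p q s t * ∫ ω, Z ω * Y (S p q) s ω ∂P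
  coeff : ∀ p q, ∃ C, ∀ s t, 0 ≤ s → s ≤ t → t ≤ T →
    |a p q s t| ≤ C * (t - s) ∧ |b p q s t| ≤ C * (t - s)

namespace IsMomentSystem

variable {I Ω : Type*} {mΩ : MeasurableSpace Ω} {P : Measure Ω} {T : ℝ}
  {𝒜 : Filtration ℝ mΩ} {D S : I → I → I} {a b : I → I → ℝ → ℝ → ℝ} {Y : I → ℝ → Ω → ℝ}

theorem bddMeas (h : IsMomentSystem P T 𝒜 D S a b Y) (p : I) {s t : ℝ} (hs : 0 ≤ s) (hst : s ≤ t)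
    (ht : t ≤ T) : BddMeas (𝒜 t) (Y p s) := by
  obtain ⟨B, hB⟩ := h.bound p
  exact ⟨(h.meas p s hs (hst.trans ht)).mono (𝒜.mono hst), B, hB s hs (hst.trans ht)⟩

theorem bddMeas_prod (h : IsMomentSystem P T 𝒜 D S a b Y) {t : ℝ} (h0 : 0 ≤ t) (ht : t ≤ T) :
    ∀ L : List I, BddMeas (𝒜 t) (fun ω => (L.map fun p => Y p t ω).prod)
  | [] => by simpa using BddMeas.const 1
  | p :: L => by
    simpa using (h.bddMeas p h0 le_rfl ht).mul (h.bddMeas_prod h0 ht L)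

theorem bddMeas_listLin (h : IsMomentSystem P T 𝒜 D S a b Y) {s t : ℝ} (hs : 0 ≤ s) (hst : s ≤ t)
    (ht : t ≤ T) : ∀ L : List I,
      BddMeas mΩ (fun ω => listLin (fun p => Y p s ω) (fun p => Y p t ω - Y p s ω) L)
  | [] => by simpa [listLin] using BddMeas.const 0
  | p :: L => by
    have h1 := (h.bddMeas p hs le_rfl (hst.trans ht)).mono (𝒜.le s)
    have h2 := (h.bddMeas p (hs.trans hst) le_rfl ht).mono (𝒜.le t)
    have h3 := (h.bddMeas_prod hs (hst.trans ht) L).mono (𝒜.le s)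
    exact ((h2.sub h1).mul h3).add (h1.mul (h.bddMeas_listLin hs hst ht L))

theorem bddMeas_listQuad (h : IsMomentSystem P T 𝒜 D S a b Y) {s t : ℝ} (hs : 0 ≤ s)
    (hst : s ≤ t) (ht : t ≤ T) : ∀ L : List I,
      BddMeas mΩ (fun ω => listQuad (fun p => Y p s ω) (fun p => Y p t ω - Y p s ω) L)
  | [] => by simpa [listQuad] using BddMeas.const 0
  | p :: L => by
    have h1 := (h.bddMeas p hs le_rfl (hst.trans ht)).mono (𝒜.le s)
    have h2 := (h.bddMeas p (hs.trans hst) le_rfl ht).mono (𝒜.le t)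
    exact ((h2.sub h1).mul (h.bddMeas_listLin hs hst ht L)).add
      (h1.mul (h.bddMeas_listQuad hs hst ht L))

theorem bddMeas_sum_abs (h : IsMomentSystem P T 𝒜 D S a b Y) {s t : ℝ} (hs : 0 ≤ s)
    (hst : s ≤ t) (ht : t ≤ T) : ∀ L : List I,
      BddMeas (𝒜 t) (fun ω => (L.map fun p => |Y p t ω - Y p s ω|).sum)
  | [] => by simpa using BddMeas.const 0
  | p :: L => by
    have h1 := h.bddMeas p hs hst ht
    have h2 := h.bddMeas p (hs.trans hst) le_rfl ht
    simpa using (h2.sub h1).abs.add (h.bddMeas_sum_abs hs hst ht L)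

theorem exists_list_bound (h : IsMomentSystem P T 𝒜 D S a b Y) : ∀ L : List I,
    ∃ B, 1 ≤ B ∧ ∀ p ∈ L, ∀ t, 0 ≤ t → t ≤ T → ∀ ω, |Y p t ω| ≤ B
  | [] => ⟨1, le_rfl, by simp⟩
  | p :: L => by
    obtain ⟨B, hB, hL⟩ := h.exists_list_bound L
    obtain ⟨B', hp⟩ := h.bound p
    refine ⟨max B B', hB.trans (le_max_left _ _), fun q hq t h0 h1 ω => ?_⟩
    rcases List.mem_cons.mp hq with rfl | hq
    · exact (hp t h0 h1 ω).trans (le_max_right _ _)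
    · exact (hL q hq t h0 h1 ω).trans (le_max_left _ _)

/-- Along uniform partitions, the increments become uniformly small. -/
theorem eventually_sum_abs_le (h : IsMomentSystem P T 𝒜 D S a b Y) {τ : ℝ} (h0 : 0 ≤ τ)
    (hτ : τ ≤ T) (ω : Ω) : ∀ (L : List I) (ε : ℝ), 0 < ε → ∀ᶠ N : ℕ in atTop, ∀ k < N,
      (L.map fun p => |Y p ((k + 1 : ℕ) * (τ / N)) ω - Y p (k * (τ / N)) ω|).sum ≤ ε
  | [], ε, hε => by simp [hε.le]
  | p :: L, ε, hε => by
    have ih := h.eventually_sum_abs_le h0 hτ ω L (ε / 2) (by positivity)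
    have huc := (isCompact_Icc.uniformContinuousOn_of_continuous (h.cont p ω))
    obtain ⟨δ, hδ, hu⟩ := Metric.uniformContinuousOn_iff.mp huc (ε / 2) (by positivity)
    have hlim : ∀ᶠ N : ℕ in atTop, τ / N < δ :=
      (tendsto_const_div_atTop_nhds_zero_nat τ).eventually_lt_const hδ
    filter_upwards [ih, hlim] with N hN hN' k hk
    have hNpos : (0 : ℝ) < N := by exact_mod_cast (Nat.zero_le k).trans_lt hk
    have hstep : 0 ≤ τ / N := by positivity
    have hmem : ∀ j : ℕ, j ≤ N → (j : ℝ) * (τ / N) ∈ Icc 0 T := by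
      intro j hj
      refine ⟨by positivity, ?_⟩
      calc (j : ℝ) * (τ / N) ≤ N * (τ / N) := by gcongr
        _ = τ := by field_simp
        _ ≤ T := hτ
    have h1 := hu _ (hmem (k + 1) hk) _ (hmem k hk.le) (by
      rw [Real.dist_eq]
      push_cast
      rw [show ((k : ℝ) + 1) * (τ / N) - k * (τ / N) = τ / N by ring, abs_of_nonneg hstep]
      exact hN')
    rw [Real.dist_eq] at h1
    simp only [List.map_cons, List.sum_cons]
    linarith [hN k hk]

variable [IsProbabilityMeasure P]

theorem integral_mul_sub (h : IsMomentSystem P T 𝒜 D S a b Y) (p : I) {s t : ℝ} (hs : 0 ≤ s)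
    (hst : s ≤ t) (ht : t ≤ T) {Z : Ω → ℝ} (hZ : BddMeas (𝒜 s) Z) :
    ∫ ω, Z ω * (Y p t ω - Y p s ω) ∂P = 0 := by
  have h1 := (h.bddMeas p hs le_rfl (hst.trans ht)).mono (𝒜.le s)
  have h2 := (h.bddMeas p (hs.trans hst) le_rfl ht).mono (𝒜.le t)
  have hZ' := hZ.mono (𝒜.le s)
  simp only [mul_sub]
  rw [integral_sub (hZ'.mul h2).integrable (hZ'.mul h1).integrable, h.mart p s t hs hst ht Z hZ,
    sub_self]

theorem integral_mul_sub_mul_sub (h : IsMomentSystem P T 𝒜 D S a b Y) (p q : I) {s t : ℝ}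
    (hs : 0 ≤ s) (hst : s ≤ t) (ht : t ≤ T) {Z : Ω → ℝ} (hZ : BddMeas (𝒜 s) Z) :
    ∫ ω, Z ω * ((Y p t ω - Y p s ω) * (Y q t ω - Y q s ω)) ∂P
      = a p q s t * ∫ ω, Z ω * Y (D p q) s ω ∂P + b p q s t * ∫ ω, Z ω * Y (S p q) s ω ∂P := by
  rw [← h.bracket p q s t hs hst ht Z hZ]
  have hp := h.bddMeas p hs le_rfl (hst.trans ht)
  have hq := h.bddMeas q hs le_rfl (hst.trans ht)
  have hp1 := hp.mono (𝒜.le s)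
  have hp2 := (h.bddMeas p (hs.trans hst) le_rfl ht).mono (𝒜.le t)
  have hq1 := hq.mono (𝒜.le s)
  have hq2 := (h.bddMeas q (hs.trans hst) le_rfl ht).mono (𝒜.le t)
  have hZ' := hZ.mono (𝒜.le s)
  have e1 := h.integral_mul_sub q hs hst ht (hZ.mul hp)
  have e2 := h.integral_mul_sub p hs hst ht (hZ.mul hq)
  have e : ∀ ω, Z ω * ((Y p t ω - Y p s ω) * (Y q t ω - Y q s ω))
      = (Z ω * (Y p t ω * Y q t ω) - Z ω * (Y p s ω * Y q s ω))
        - (Z ω * Y p s ω * (Y q t ω - Y q s ω) + Z ω * Y q s ω * (Y p t ω - Y p s ω)) :=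
    fun ω => by ring
  simp only [e]
  have i1 := hZ'.mul (hp2.mul hq2)
  have i2 := hZ'.mul (hp1.mul hq1)
  have i3 := (hZ'.mul hp1).mul (hq2.sub hq1)
  have i4 := (hZ'.mul hq1).mul (hp2.sub hp1)
  rw [integral_sub (i1.sub i2).integrable (i3.add i4).integrable,
    integral_sub i1.integrable i2.integrable, integral_add i3.integrable i4.integrable, e1, e2]
  ring

theorem integral_mul_listLin (h : IsMomentSystem P T 𝒜 D S a b Y) {s t : ℝ} (hs : 0 ≤ s)
    (hst : s ≤ t) (ht : t ≤ T) : ∀ (L : List I) {Z : Ω → ℝ}, BddMeas (𝒜 s) Z →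
      ∫ ω, Z ω * listLin (fun p => Y p s ω) (fun p => Y p t ω - Y p s ω) L ∂P = 0
  | [], Z, hZ => by simp [listLin]
  | p :: L, Z, hZ => by
    have hp := h.bddMeas p hs le_rfl (hst.trans ht)
    have hp2 := (h.bddMeas p (hs.trans hst) le_rfl ht).mono (𝒜.le t)
    have hL := h.bddMeas_prod hs (hst.trans ht) L
    have ih := h.integral_mul_listLin hs hst ht L (hZ.mul hp)
    have e0 := h.integral_mul_sub p hs hst ht (hZ.mul hL)
    have e : ∀ ω, Z ω * listLin (fun p => Y p s ω) (fun p => Y p t ω - Y p s ω) (p :: L)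
        = Z ω * (L.map fun p => Y p s ω).prod * (Y p t ω - Y p s ω)
          + Z ω * Y p s ω * listLin (fun p => Y p s ω) (fun p => Y p t ω - Y p s ω) L :=
      fun ω => by simp only [listLin]; ring
    simp only [e]
    rw [integral_add (((hZ.mul hL).mono (𝒜.le s)).mul (hp2.sub (hp.mono (𝒜.le s)))).integrable
      (((hZ.mul hp).mono (𝒜.le s)).mul (h.bddMeas_listLin hs hst ht L)).integrable, ih, e0,
      add_zero]

/-- Conditional second moments of increments are bounded by the elapsed time. -/
theorem exists_integral_mul_sum_abs_sq_le (h : IsMomentSystem P T 𝒜 D S a b Y) :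
    ∀ L : List I, ∃ C, 0 ≤ C ∧ ∀ s t, 0 ≤ s → s ≤ t → t ≤ T → ∀ Z, BddMeas (𝒜 s) Z → (∀ ω, 0 ≤ Z ω) →
      ∫ ω, Z ω * (L.map fun p => |Y p t ω - Y p s ω|).sum ^ 2 ∂P ≤ C * (t - s) * ∫ ω, Z ω ∂P
  | [] => ⟨0, le_rfl, by simp⟩
  | p :: L => by
    obtain ⟨C, hC0, hC⟩ := h.exists_integral_mul_sum_abs_sq_le L
    obtain ⟨K, hK⟩ := h.coeff p p
    obtain ⟨B₁, hB₁⟩ := h.bound (D p p)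
    obtain ⟨B₂, hB₂⟩ := h.bound (S p p)
    refine ⟨2 * (|K| * (|B₁| + |B₂|)) + 2 * C, by positivity,
      fun s t hs hst ht Z hZ hZ0 => ?_⟩
    have hp := (h.bddMeas p hs le_rfl (hst.trans ht)).mono (𝒜.le s)
    have hp2 := (h.bddMeas p (hs.trans hst) le_rfl ht).mono (𝒜.le t)
    have hZ' := hZ.mono (𝒜.le s)
    have hL := (h.bddMeas_sum_abs hs hst ht L).mono (𝒜.le t)
    have i1 := (hZ'.mul ((hp2.sub hp).mul (hp2.sub hp))).integrable (P := P)
    have i2 := (hZ'.mul (hL.pow 2)).integrable (P := P)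
    have i3 := (hZ'.mul ((h.bddMeas_sum_abs hs hst ht (p :: L)).mono (𝒜.le t) |>.pow 2)).integrable
      (P := P)
    have hY : ∀ q B, (∀ t, 0 ≤ t → t ≤ T → ∀ ω, |Y q t ω| ≤ B) →
        |∫ ω, Z ω * Y q s ω ∂P| ≤ |B| * ∫ ω, Z ω ∂P := by
      intro q B hB
      have hq := (h.bddMeas q hs le_rfl (hst.trans ht)).mono (𝒜.le s)
      refine (abs_integral_le_integral_abs).trans ?_
      rw [← integral_const_mul]
      refine integral_mono (hZ'.mul hq).abs.integrable ((BddMeas.const _).mul hZ').integrable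
        fun ω => ?_
      simp only
      rw [abs_mul, abs_of_nonneg (hZ0 ω), mul_comm]
      exact mul_le_mul_of_nonneg_right ((hB s hs (hst.trans ht) ω).trans (le_abs_self _)) (hZ0 ω)
    have hδ : ∫ ω, Z ω * ((Y p t ω - Y p s ω) * (Y p t ω - Y p s ω)) ∂P
        ≤ |K| * (|B₁| + |B₂|) * (t - s) * ∫ ω, Z ω ∂P := by
      rw [h.integral_mul_sub_mul_sub p p hs hst ht hZ]
      have hts : 0 ≤ t - s := by linarith
      have hI : 0 ≤ ∫ ω, Z ω ∂P := integral_nonneg hZ0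
      have k1 : |a p p s t| ≤ |K| * (t - s) := (hK s t hs hst ht).1.trans
        (mul_le_mul_of_nonneg_right (le_abs_self _) hts)
      have k2 : |b p p s t| ≤ |K| * (t - s) := (hK s t hs hst ht).2.trans
        (mul_le_mul_of_nonneg_right (le_abs_self _) hts)
      calc _ ≤ |a p p s t| * |∫ ω, Z ω * Y (D p p) s ω ∂P|
            + |b p p s t| * |∫ ω, Z ω * Y (S p p) s ω ∂P| := by
            rw [← abs_mul, ← abs_mul]
            exact add_le_add (le_abs_self _) (le_abs_self _)
        _ ≤ |K| * (t - s) * (|B₁| * ∫ ω, Z ω ∂P) + |K| * (t - s) * (|B₂| * ∫ ω, Z ω ∂P) := by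
            gcongr
            · exact hY _ _ hB₁
            · exact hY _ _ hB₂
        _ = _ := by ring
    calc _ ≤ ∫ ω, (2 * (Z ω * ((Y p t ω - Y p s ω) * (Y p t ω - Y p s ω)))
            + 2 * (Z ω * (L.map fun p => |Y p t ω - Y p s ω|).sum ^ 2)) ∂P := by
          refine integral_mono i3 ((i1.const_mul 2).add (i2.const_mul 2)) fun ω => ?_
          simp only [List.map_cons, List.sum_cons]
          set σ := (L.map fun p => |Y p t ω - Y p s ω|).sum
          have : Z ω * (|Y p t ω - Y p s ω| + σ) ^ 2
              ≤ Z ω * (2 * |Y p t ω - Y p s ω| ^ 2 + 2 * σ ^ 2) := by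
            refine mul_le_mul_of_nonneg_left ?_ (hZ0 ω)
            nlinarith [sq_nonneg (|Y p t ω - Y p s ω| - σ)]
          rw [sq_abs] at this
          linarith
      _ = 2 * ∫ ω, Z ω * ((Y p t ω - Y p s ω) * (Y p t ω - Y p s ω)) ∂P
            + 2 * ∫ ω, Z ω * (L.map fun p => |Y p t ω - Y p s ω|).sum ^ 2 ∂P := by
          rw [integral_add (i1.const_mul 2) (i2.const_mul 2), integral_const_mul,
            integral_const_mul]
      _ ≤ _ := by
          have := hC s t hs hst ht Z hZ hZ0
          linarith

theorem tendsto_sum_cube (h : IsMomentSystem P T 𝒜 D S a b Y) {τ : ℝ} (h0 : 0 ≤ τ) (hτ : τ ≤ T)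
    (L : List I) : Tendsto (fun N : ℕ => ∑ k ∈ Finset.range N, ∫ ω,
      (L.map fun p => |Y p ((k + 1 : ℕ) * (τ / N)) ω - Y p (k * (τ / N)) ω|).sum ^ 3 ∂P)
      atTop (nhds 0) := by
  obtain ⟨B, hB1, hB⟩ := h.exists_list_bound L
  obtain ⟨C, hC0, hC⟩ := h.exists_integral_mul_sum_abs_sq_le L
  have hmem : ∀ N j : ℕ, j ≤ N → 0 ≤ (j : ℝ) * (τ / N) ∧ (j : ℝ) * (τ / N) ≤ τ := by
    intro N j hj
    refine ⟨by positivity, ?_⟩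
    rcases Nat.eq_zero_or_pos N with rfl | hN
    · simpa using h0
    · have : (0 : ℝ) < N := by exact_mod_cast hN
      calc (j : ℝ) * (τ / N) ≤ N * (τ / N) := by gcongr
        _ = τ := by field_simp
  have hstep : ∀ N k : ℕ, (k : ℝ) * (τ / N) ≤ (k + 1 : ℕ) * (τ / N) := by
    intro N k
    gcongr
    omega
  set A : ℝ := L.length * (2 * B) with hA
  have hA0 : 0 ≤ A := by positivity
  set F : ℕ → ℕ → Ω → ℝ := fun N k ω =>
    (L.map fun p => |Y p ((k + 1 : ℕ) * (τ / N)) ω - Y p (k * (τ / N)) ω|).sum with hF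
  have hFm : ∀ N, ∀ k < N, BddMeas (𝒜 ((k + 1 : ℕ) * (τ / N))) (F N k) := fun N k hk =>
    h.bddMeas_sum_abs (hmem N k hk.le).1 (hstep N k) ((hmem N (k + 1) hk).2.trans hτ) L
  have hF0 : ∀ N k ω, 0 ≤ F N k ω := fun N k ω => list_sum_abs_nonneg _ _
  have hFA : ∀ N, ∀ k < N, ∀ ω, F N k ω ≤ A := by
    intro N k hk ω
    have := List.sum_le_card_nsmul (L.map fun p =>
      |Y p ((k + 1 : ℕ) * (τ / N)) ω - Y p (k * (τ / N)) ω|) (2 * B) (by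
        intro x hx
        obtain ⟨p, hp, rfl⟩ := List.mem_map.mp hx
        have h1 := hB p hp _ (hmem N k hk.le).1 ((hmem N k hk.le).2.trans hτ) ω
        have h2 := hB p hp _ (hmem N (k + 1) hk).1 ((hmem N (k + 1) hk).2.trans hτ) ω
        exact (abs_sub _ _).trans (by linarith))
    simpa only [List.length_map, nsmul_eq_mul] using this
  have hcond : ∀ N k : ℕ, k < N → ∀ Z, BddMeas (𝒜 (k * (τ / N))) Z → (∀ ω, 0 ≤ Z ω) →
      ∫ ω, Z ω * F N k ω ^ 2 ∂P ≤ C * (τ / N) * ∫ ω, Z ω ∂P := by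
    intro N k hk Z hZ hZ0
    have := hC _ _ (hmem N k hk.le).1 (hstep N k) ((hmem N (k + 1) hk).2.trans hτ) Z hZ hZ0
    rwa [show ((k + 1 : ℕ) : ℝ) * (τ / N) - k * (τ / N) = τ / N by push_cast; ring] at this
  have hV : ∀ N k : ℕ, k ≤ N → BddMeas (𝒜 (k * (τ / N)))
      (fun ω => ∑ j ∈ Finset.range k, F N j ω ^ 2) := by
    intro N k hk
    refine BddMeas.sum fun j hj => ?_
    have hjk : j < k := Finset.mem_range.mp hj
    refine ((hFm N j (hjk.trans_le hk)).mono (𝒜.mono ?_)).pow 2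
    gcongr
    omega
  have hVint : ∀ N k, k ≤ N → ∫ ω, ∑ j ∈ Finset.range k, F N j ω ^ 2 ∂P ≤ C * (k * (τ / N)) := by
    intro N k
    induction k with
    | zero => simp
    | succ k ih =>
      intro hk
      have ih := ih (by omega)
      have i1 := ((hV N k (by omega)).mono (𝒜.le _)).integrable (P := P)
      have i2 := (((hFm N k hk).mono (𝒜.le _)).pow 2).integrable (P := P)
      have hc := hcond N k hk _ (BddMeas.const 1) fun _ => zero_le_one
      simp only [one_mul, integral_const, probReal_univ, smul_eq_mul, mul_one] at hc
      simp only [Finset.sum_range_succ]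
      rw [integral_add i1 i2]
      push_cast
      linarith
  refine tendsto_sum_integral_cube (S := F) (B := A) (K := τ * (2 * C * (C * τ) + A ^ 2 * C))
    hA0 (fun N k hk => (hFm N k hk).mono (𝒜.le _)) (fun N k _ => hF0 N k) hFA
    (fun ω ε hε => h.eventually_sum_abs_le h0 hτ ω L ε hε) fun N => ?_
  have hrec : ∀ k, k ≤ N → ∫ ω, (∑ j ∈ Finset.range k, F N j ω ^ 2) ^ 2 ∂P
      ≤ (k * (τ / N)) * (2 * C * (C * τ) + A ^ 2 * C) := by
    intro k
    induction k with
    | zero => simp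
    | succ k ih =>
      intro hk
      have ih := ih (by omega)
      have hVk := hV N k (by omega)
      have hVk' := hVk.mono (𝒜.le _)
      have hFk := (hFm N k hk).mono (𝒜.le _)
      have c1 := hcond N k hk _ hVk fun ω => Finset.sum_nonneg fun j _ => by positivity
      have c2 := hcond N k hk _ (BddMeas.const 1) fun _ => zero_le_one
      simp only [one_mul, integral_const, probReal_univ, smul_eq_mul, mul_one] at c2
      have c3 := hVint N k (by omega)
      have hst : 0 ≤ τ / N := by positivity
      have c4 : C * (k * (τ / N)) ≤ C * τ :=
        mul_le_mul_of_nonneg_left (hmem N k (by omega)).2 hC0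
      have i1 := hVk'.pow 2
      have i2 := (BddMeas.const 2).mul (hVk'.mul (hFk.pow 2))
      have i3 := (BddMeas.const (A ^ 2)).mul (hFk.pow 2)
      have i4 := (hVk'.add (hFk.pow 2)).pow 2
      simp only [Finset.sum_range_succ]
      calc _ ≤ ∫ ω, ((∑ j ∈ Finset.range k, F N j ω ^ 2) ^ 2
              + 2 * ((∑ j ∈ Finset.range k, F N j ω ^ 2) * F N k ω ^ 2)
              + A ^ 2 * F N k ω ^ 2) ∂P := by
            refine integral_mono i4.integrable ((i1.add i2).add i3).integrable fun ω => ?_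
            simp only
            have : F N k ω ^ 2 ≤ A ^ 2 := pow_le_pow_left₀ (hF0 N k ω) (hFA N k hk ω) 2
            nlinarith [sq_nonneg (F N k ω)]
        _ = ∫ ω, (∑ j ∈ Finset.range k, F N j ω ^ 2) ^ 2 ∂P
              + 2 * ∫ ω, (∑ j ∈ Finset.range k, F N j ω ^ 2) * F N k ω ^ 2 ∂P
              + A ^ 2 * ∫ ω, F N k ω ^ 2 ∂P := by
            rw [integral_add (i1.add i2).integrable i3.integrable,
              integral_add i1.integrable i2.integrable, integral_const_mul, integral_const_mul]
        _ ≤ (k * (τ / N)) * (2 * C * (C * τ) + A ^ 2 * C) + 2 * (C * (τ / N) * (C * τ))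
              + A ^ 2 * (C * (τ / N)) := by
            gcongr
            · exact c1.trans (mul_le_mul_of_nonneg_left (c3.trans c4) (by positivity))
        _ = _ := by push_cast; ring
  refine (hrec N le_rfl).trans ?_
  exact mul_le_mul_of_nonneg_right (hmem N N le_rfl).2 (by positivity)

end IsMomentSystem

namespace IsMomentSystem

variable {I Ω₁ Ω₂ : Type*} {mΩ₁ : MeasurableSpace Ω₁} {mΩ₂ : MeasurableSpace Ω₂}
  {P : Measure Ω₁} {Q : Measure Ω₂} [IsProbabilityMeasure P] [IsProbabilityMeasure Q] {T : ℝ}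
  {𝒜 : Filtration ℝ mΩ₁} {ℬ : Filtration ℝ mΩ₂} {D S : I → I → I} {a b : I → I → ℝ → ℝ → ℝ}
  {Y : I → ℝ → Ω₁ → ℝ} {W : I → ℝ → Ω₂ → ℝ}

theorem integral_cross (h : IsMomentSystem P T 𝒜 D S a b Y) {s t : ℝ} (hs : 0 ≤ s) (hst : s ≤ t)
    (ht : t ≤ T) (p q : I) (L L' : List I) :
    ∫ ω, (L'.map fun r => Y r s ω).prod * ((Y p t ω - Y p s ω)
        * listLin (fun r => Y r s ω) (fun r => Y r t ω - Y r s ω) (q :: L)) ∂P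
      = a p q s t * ∫ ω, ((D p q :: (L' ++ L)).map fun r => Y r s ω).prod ∂P
        + b p q s t * ∫ ω, ((S p q :: (L' ++ L)).map fun r => Y r s ω).prod ∂P
        + ∫ ω, ((q :: L').map fun r => Y r s ω).prod * ((Y p t ω - Y p s ω)
          * listLin (fun r => Y r s ω) (fun r => Y r t ω - Y r s ω) L) ∂P := by
  have hZ := h.bddMeas_prod hs (hst.trans ht) (L' ++ L)
  have hL' := h.bddMeas_prod hs (hst.trans ht) (q :: L')
  have hp := (h.bddMeas p hs le_rfl (hst.trans ht)).mono (𝒜.le s)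
  have hp2 := (h.bddMeas p (hs.trans hst) le_rfl ht).mono (𝒜.le t)
  have hq := (h.bddMeas q hs le_rfl (hst.trans ht)).mono (𝒜.le s)
  have hq2 := (h.bddMeas q (hs.trans hst) le_rfl ht).mono (𝒜.le t)
  have e1 := h.integral_mul_sub_mul_sub p q hs hst ht hZ
  have e : ∀ ω, (L'.map fun r => Y r s ω).prod * ((Y p t ω - Y p s ω)
        * listLin (fun r => Y r s ω) (fun r => Y r t ω - Y r s ω) (q :: L))
      = ((L' ++ L).map fun r => Y r s ω).prod * ((Y p t ω - Y p s ω) * (Y q t ω - Y q s ω))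
        + ((q :: L').map fun r => Y r s ω).prod * ((Y p t ω - Y p s ω)
          * listLin (fun r => Y r s ω) (fun r => Y r t ω - Y r s ω) L) := by
    intro ω
    simp only [listLin, List.map_append, List.prod_append, List.map_cons, List.prod_cons]
    ring
  simp only [e]
  rw [integral_add ((hZ.mono (𝒜.le s)).mul ((hp2.sub hp).mul (hq2.sub hq))).integrable
    ((hL'.mono (𝒜.le s)).mul ((hp2.sub hp).mul (h.bddMeas_listLin hs hst ht L))).integrable, e1]
  simp only [List.map_cons, List.prod_cons, mul_comm]

theorem integral_cross_eq (h : IsMomentSystem P T 𝒜 D S a b Y)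
    (h' : IsMomentSystem Q T ℬ D S a b W) {s t : ℝ} (hs : 0 ≤ s) (hst : s ≤ t) (ht : t ≤ T)
    (p : I) : ∀ L L' : List I,
    (∀ K : List I, K.length = L.length + L'.length →
      ∫ ω, (K.map fun r => Y r s ω).prod ∂P = ∫ ω, (K.map fun r => W r s ω).prod ∂Q) →
    ∫ ω, (L'.map fun r => Y r s ω).prod * ((Y p t ω - Y p s ω)
        * listLin (fun r => Y r s ω) (fun r => Y r t ω - Y r s ω) L) ∂P
      = ∫ ω, (L'.map fun r => W r s ω).prod * ((W p t ω - W p s ω)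
        * listLin (fun r => W r s ω) (fun r => W r t ω - W r s ω) L) ∂Q
  | [], L', _ => by simp [listLin]
  | q :: L, L', hK => by
    rw [h.integral_cross hs hst ht, h'.integral_cross hs hst ht,
      h.integral_cross_eq h' hs hst ht p L (q :: L') fun K hlen => hK K (by
        simp only [List.length_cons] at hlen ⊢; omega),
      hK _ (by simp only [List.length_cons, List.length_append]; omega),
      hK _ (by simp only [List.length_cons, List.length_append]; omega)]

theorem integral_prod_mul_listQuad_cons (h : IsMomentSystem P T 𝒜 D S a b Y) {s t : ℝ}
    (hs : 0 ≤ s) (hst : s ≤ t) (ht : t ≤ T) (p : I) (L L' : List I) :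
    ∫ ω, (L'.map fun r => Y r s ω).prod
        * listQuad (fun r => Y r s ω) (fun r => Y r t ω - Y r s ω) (p :: L) ∂P
      = ∫ ω, (L'.map fun r => Y r s ω).prod * ((Y p t ω - Y p s ω)
          * listLin (fun r => Y r s ω) (fun r => Y r t ω - Y r s ω) L) ∂P
        + ∫ ω, ((p :: L').map fun r => Y r s ω).prod
          * listQuad (fun r => Y r s ω) (fun r => Y r t ω - Y r s ω) L ∂P := by
  have hL := (h.bddMeas_prod hs (hst.trans ht) L').mono (𝒜.le s)
  have hL' := (h.bddMeas_prod hs (hst.trans ht) (p :: L')).mono (𝒜.le s)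
  have hp := (h.bddMeas p hs le_rfl (hst.trans ht)).mono (𝒜.le s)
  have hp2 := (h.bddMeas p (hs.trans hst) le_rfl ht).mono (𝒜.le t)
  rw [← integral_add (hL.mul ((hp2.sub hp).mul (h.bddMeas_listLin hs hst ht L))).integrable
    (hL'.mul (h.bddMeas_listQuad hs hst ht L)).integrable]
  refine integral_congr_ae (ae_of_all _ fun ω => ?_)
  simp only [listQuad, List.map_cons, List.prod_cons]
  ring

theorem integral_prod_mul_listQuad_eq (h : IsMomentSystem P T 𝒜 D S a b Y)
    (h' : IsMomentSystem Q T ℬ D S a b W) {s t : ℝ} (hs : 0 ≤ s) (hst : s ≤ t) (ht : t ≤ T) :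
    ∀ L L' : List I,
    (∀ K : List I, K.length + 1 = L.length + L'.length →
      ∫ ω, (K.map fun r => Y r s ω).prod ∂P = ∫ ω, (K.map fun r => W r s ω).prod ∂Q) →
    ∫ ω, (L'.map fun r => Y r s ω).prod
        * listQuad (fun r => Y r s ω) (fun r => Y r t ω - Y r s ω) L ∂P
      = ∫ ω, (L'.map fun r => W r s ω).prod
        * listQuad (fun r => W r s ω) (fun r => W r t ω - W r s ω) L ∂Q
  | [], L', _ => by simp [listQuad]
  | p :: L, L', hK => by
    rw [h.integral_prod_mul_listQuad_cons hs hst ht, h'.integral_prod_mul_listQuad_cons hs hst ht,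
      h.integral_cross_eq h' hs hst ht p L L' fun K hlen => hK K (by
        simp only [List.length_cons]; omega),
      h.integral_prod_mul_listQuad_eq h' hs hst ht L (p :: L') fun K hlen => hK K (by
        simp only [List.length_cons] at hlen ⊢; omega)]

/-- One-step expansion of mixed moments: up to a cubic error, the increment is given by the
quadratic term. -/
theorem abs_integral_prod_sub_le (h : IsMomentSystem P T 𝒜 D S a b Y) {s t : ℝ} (hs : 0 ≤ s)
    (hst : s ≤ t) (ht : t ≤ T) (L : List I) {B : ℝ} (hB1 : 1 ≤ B)
    (hB : ∀ p ∈ L, ∀ t, 0 ≤ t → t ≤ T → ∀ ω, |Y p t ω| ≤ B) :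
    |∫ ω, (L.map fun r => Y r t ω).prod ∂P - ∫ ω, (L.map fun r => Y r s ω).prod ∂P
        - ∫ ω, listQuad (fun r => Y r s ω) (fun r => Y r t ω - Y r s ω) L ∂P|
      ≤ B ^ L.length * ∫ ω, (L.map fun p => |Y p t ω - Y p s ω|).sum ^ 3 ∂P := by
  have b1 := (h.bddMeas_prod (hs.trans hst) ht L).mono (𝒜.le t)
  have b2 := (h.bddMeas_prod hs (hst.trans ht) L).mono (𝒜.le s)
  have b3 := h.bddMeas_listLin hs hst ht L
  have b4 := h.bddMeas_listQuad hs hst ht L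
  have b5 := (h.bddMeas_sum_abs hs hst ht L).mono (𝒜.le t)
  have hlin := h.integral_mul_listLin hs hst ht L (BddMeas.const 1)
  simp only [one_mul] at hlin
  have e : ∫ ω, (L.map fun r => Y r t ω).prod ∂P - ∫ ω, (L.map fun r => Y r s ω).prod ∂P
        - ∫ ω, listQuad (fun r => Y r s ω) (fun r => Y r t ω - Y r s ω) L ∂P
      = ∫ ω, ((L.map fun r => Y r t ω).prod - (L.map fun r => Y r s ω).prod
        - listLin (fun r => Y r s ω) (fun r => Y r t ω - Y r s ω) L
        - listQuad (fun r => Y r s ω) (fun r => Y r t ω - Y r s ω) L) ∂P := by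
    rw [integral_sub ((b1.sub b2).sub b3).integrable b4.integrable,
      integral_sub (b1.sub b2).integrable b3.integrable,
      integral_sub b1.integrable b2.integrable, hlin, sub_zero]
  rw [e, ← integral_const_mul]
  refine abs_integral_le_integral_abs.trans ?_
  refine integral_mono (((b1.sub b2).sub b3).sub b4).abs.integrable
    ((BddMeas.const _).mul (b5.pow 3)).integrable fun ω => ?_
  have := abs_list_prod_add_sub_le (y := fun r => Y r s ω) (δ := fun r => Y r t ω - Y r s ω) hB1
    (L := L) (fun p hp => hB p hp s hs (hst.trans ht) ω)
    (fun p hp => by simpa using hB p hp t (hs.trans hst) ht ω)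
  simpa only [add_sub_cancel] using this

/-- Mixed moments of a moment system are determined by its initial values. -/
theorem integral_prod_eq (h : IsMomentSystem P T 𝒜 D S a b Y)
    (h' : IsMomentSystem Q T ℬ D S a b W) {y : I → ℝ} (hY : ∀ p ω, Y p 0 ω = y p)
    (hW : ∀ p ω, W p 0 ω = y p) : ∀ (n : ℕ) (L : List I), L.length = n → ∀ τ, 0 ≤ τ → τ ≤ T →
    ∫ ω, (L.map fun r => Y r τ ω).prod ∂P = ∫ ω, (L.map fun r => W r τ ω).prod ∂Q := by
  intro n
  induction n with
  | zero =>
    intro L hL τ _ _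
    rw [List.length_eq_zero_iff] at hL
    subst hL
    simp
  | succ n ih =>
    intro L hL τ h0 hτ
    obtain ⟨B₁, hB₁, hLB₁⟩ := h.exists_list_bound L
    obtain ⟨B₂, hB₂, hLB₂⟩ := h'.exists_list_bound L
    set f : ℝ → ℝ := fun t =>
      ∫ ω, (L.map fun r => Y r t ω).prod ∂P - ∫ ω, (L.map fun r => W r t ω).prod ∂Q with hf
    have hmem : ∀ N j : ℕ, j ≤ N → 0 ≤ (j : ℝ) * (τ / N) ∧ (j : ℝ) * (τ / N) ≤ T := by
      intro N j hj
      refine ⟨by positivity, ?_⟩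
      rcases Nat.eq_zero_or_pos N with rfl | hN
      · simpa using h0.trans hτ
      · have : (0 : ℝ) < N := by exact_mod_cast hN
        calc (j : ℝ) * (τ / N) ≤ N * (τ / N) := by gcongr
          _ = τ := by field_simp
          _ ≤ T := hτ
    have hstep : ∀ N k : ℕ, (k : ℝ) * (τ / N) ≤ (k + 1 : ℕ) * (τ / N) := by
      intro N k
      gcongr
      omega
    set g : ℕ → ℝ := fun N =>
      B₁ ^ L.length * ∑ k ∈ Finset.range N, ∫ ω,
        (L.map fun p => |Y p ((k + 1 : ℕ) * (τ / N)) ω - Y p (k * (τ / N)) ω|).sum ^ 3 ∂P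
      + B₂ ^ L.length * ∑ k ∈ Finset.range N, ∫ ω,
        (L.map fun p => |W p ((k + 1 : ℕ) * (τ / N)) ω - W p (k * (τ / N)) ω|).sum ^ 3 ∂Q with hg
    have hglim : Tendsto g atTop (nhds 0) := by
      have := ((h.tendsto_sum_cube h0 hτ L).const_mul (B₁ ^ L.length)).add
        ((h'.tendsto_sum_cube h0 hτ L).const_mul (B₂ ^ L.length))
      simpa only [mul_zero, add_zero] using this
    have hbound : ∀ N : ℕ, |f (N * (τ / N)) - f (0 * (τ / N))| ≤ g N := by
      intro N
      have htel := Finset.sum_range_sub (fun k : ℕ => f (k * (τ / N))) N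
      simp only [Nat.cast_zero] at htel
      rw [← htel]
      refine (Finset.abs_sum_le_sum_abs _ _).trans ?_
      rw [hg]
      simp only [Finset.mul_sum]
      rw [← Finset.sum_add_distrib]
      refine Finset.sum_le_sum fun k hk => ?_
      have hk := Finset.mem_range.mp hk
      have hk0 := (hmem N k hk.le).1
      have hk1 := (hmem N (k + 1) hk).2
      have e1 := h.abs_integral_prod_sub_le hk0 (hstep N k) hk1 L hB₁ hLB₁
      have e2 := h'.abs_integral_prod_sub_le hk0 (hstep N k) hk1 L hB₂ hLB₂
      have e3 := h.integral_prod_mul_listQuad_eq h' hk0 (hstep N k) hk1 L [] fun K hlen =>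
        ih K (by simp only [List.length_nil] at hlen; omega) _ hk0 (hmem N k hk.le).2
      simp only [List.map_nil, List.prod_nil, one_mul] at e3
      rw [abs_le] at e1 e2 ⊢
      simp only [hf]
      constructor <;> linarith [e1.1, e1.2, e2.1, e2.2]
    have hf0 : f 0 = 0 := by simp [hf, hY, hW]
    have hfτ : |f τ| ≤ 0 := by
      refine ge_of_tendsto hglim ?_
      filter_upwards [eventually_gt_atTop 0] with N hN
      have := hbound N
      have hN' : (N : ℝ) ≠ 0 := by positivity
      rwa [zero_mul, hf0, sub_zero, mul_div_cancel₀ τ hN'] at this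
    exact sub_eq_zero.mp (abs_eq_zero.mp (le_antisymm hfτ (abs_nonneg _)))

end IsMomentSystem

/-- If `u' = v - C u` on `[s, t]` in integral form, then `(e^{C r} u)' = e^{C r} v` there. -/
theorem exp_mul_sub_eq_integral {u v : ℝ → ℝ} {C s t : ℝ} (hst : s ≤ t) (hu : Continuous u)
    (hv : Continuous v)
    (h : ∀ r ∈ Icc s t, u r = u s + ∫ x in s..r, (v x - C * u x)) :
    Real.exp (C * t) * u t - Real.exp (C * s) * u s = ∫ r in s..t, Real.exp (C * r) * v r := by
  set w : ℝ → ℝ := fun r => u s + ∫ x in s..r, (v x - C * u x) with hw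
  have hc : Continuous fun x => v x - C * u x := by fun_prop
  have hd : ∀ r, HasDerivAt w (v r - C * u r) r := fun r =>
    (intervalIntegral.integral_hasDerivAt_right (hc.intervalIntegrable _ _)
      (hc.stronglyMeasurableAtFilter _ _) hc.continuousAt).const_add _
  have he : ∀ r, HasDerivAt (fun r => Real.exp (C * r)) (Real.exp (C * r) * C) r := fun r => by
    simpa using ((hasDerivAt_id r).const_mul C).exp
  have hwc : Continuous w := continuous_iff_continuousAt.2 fun r => (hd r).continuousAt
  have h1 := intervalIntegral.integral_eq_sub_of_hasDerivAt (a := s) (b := t)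
    (f := fun r => Real.exp (C * r) * w r)
    (f' := fun r => Real.exp (C * r) * C * w r + Real.exp (C * r) * (v r - C * u r))
    (fun r _ => (he r).mul (hd r)) (Continuous.intervalIntegrable (by fun_prop) _ _)
  rw [h t ⟨hst, le_rfl⟩]
  have hs : w s = u s := by simp [hw]
  calc _ = Real.exp (C * t) * w t - Real.exp (C * s) * w s := by rw [hs]
    _ = _ := by
      rw [← h1]
      refine intervalIntegral.integral_congr fun r hr => ?_
      rw [uIcc_of_le hst] at hr
      have := h r hr
      simp only [hw]
      rw [← this]
      ring

/-- A uniformly bounded family of `m`-measurable functions, continuous in the time parameter. -/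
structure BddCont {Ω : Type*} (m : MeasurableSpace Ω) (F : ℝ → Ω → ℝ) : Prop where
  cont : ∀ ω, Continuous fun r => F r ω
  meas : ∀ r, StronglyMeasurable[m] (F r)
  bound : ∃ C, ∀ r ω, |F r ω| ≤ C

namespace BddCont

variable {Ω : Type*} {m mΩ : MeasurableSpace Ω} {F G : ℝ → Ω → ℝ}

theorem mul (hF : BddCont m F) (hG : BddCont m G) : BddCont m fun r ω => F r ω * G r ω := by
  obtain ⟨C, hC⟩ := hF.bound
  obtain ⟨D, hD⟩ := hG.bound
  refine ⟨fun ω => (hF.cont ω).mul (hG.cont ω), fun r => (hF.meas r).mul (hG.meas r), C * D,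
    fun r ω => ?_⟩
  rw [abs_mul]
  exact mul_le_mul (hC r ω) (hD r ω) (abs_nonneg _) ((abs_nonneg _).trans (hC r ω))

theorem add (hF : BddCont m F) (hG : BddCont m G) : BddCont m fun r ω => F r ω + G r ω := by
  obtain ⟨C, hC⟩ := hF.bound
  obtain ⟨D, hD⟩ := hG.bound
  exact ⟨fun ω => (hF.cont ω).add (hG.cont ω), fun r => (hF.meas r).add (hG.meas r), C + D,
    fun r ω => (abs_add_le _ _).trans (add_le_add (hC r ω) (hD r ω))⟩

theorem const {Z : Ω → ℝ} (hZ : BddMeas m Z) : BddCont m fun _ ω => Z ω :=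
  ⟨fun _ => continuous_const, fun _ => hZ.1, hZ.2.imp fun _ h _ ω => h ω⟩

theorem const_mul (c : ℝ) (hF : BddCont m F) : BddCont m fun r ω => c * F r ω :=
  (const (BddMeas.const c)).mul hF

theorem sub (hF : BddCont m F) (hG : BddCont m G) : BddCont m fun r ω => F r ω - G r ω := by
  simpa [sub_eq_add_neg] using hF.add (hG.const_mul (-1))

theorem bddMeas (hF : BddCont m F) (r : ℝ) : BddMeas m (F r) :=
  ⟨hF.meas r, hF.bound.imp fun _ h ω => h r ω⟩

theorem mono (hF : BddCont m F) (h : m ≤ mΩ) : BddCont mΩ F :=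
  ⟨hF.cont, fun r => (hF.meas r).mono h, hF.bound⟩

theorem stronglyMeasurable_uncurry {F : ℝ → Ω → ℝ} (hF : BddCont mΩ F) :
    StronglyMeasurable (Function.uncurry F) :=
  stronglyMeasurable_uncurry_of_continuous_of_stronglyMeasurable hF.cont hF.meas

theorem bddMeas_intervalIntegral (hF : BddCont mΩ F) (s t : ℝ) :
    BddMeas mΩ fun ω => ∫ r in s..t, F r ω := by
  obtain ⟨C, hC⟩ := hF.bound
  constructor
  · have h := hF.stronglyMeasurable_uncurry
    simp only [intervalIntegral]
    exact (StronglyMeasurable.integral_prod_left' (μ := volume.restrict (Ioc s t)) h).sub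
      (StronglyMeasurable.integral_prod_left' (μ := volume.restrict (Ioc t s)) h)
  · refine ⟨C * |t - s|, fun ω => ?_⟩
    simpa using intervalIntegral.norm_integral_le_of_norm_le_const (f := fun r => F r ω)
      (a := s) (b := t) (C := C) fun r _ => hC r ω

theorem continuous_integral {P : Measure[mΩ] Ω} [IsFiniteMeasure P] (hF : BddCont mΩ F) :
    Continuous fun r => ∫ ω, F r ω ∂P := by
  obtain ⟨C, hC⟩ := hF.bound
  exact continuous_of_dominated (fun r => (hF.meas r).aestronglyMeasurable)
    (fun r => ae_of_all _ (hC r)) (integrable_const C) (ae_of_all _ hF.cont)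

theorem integral_intervalIntegral {P : Measure[mΩ] Ω} [IsFiniteMeasure P] (hF : BddCont mΩ F)
    (s t : ℝ) : ∫ ω, (∫ r in s..t, F r ω) ∂P = ∫ r in s..t, ∫ ω, F r ω ∂P := by
  obtain ⟨C, hC⟩ := hF.bound
  refine (MeasureTheory.intervalIntegral_integral_swap ?_).symm
  have : IsFiniteMeasure (volume.restrict (uIoc s t)) := by
    unfold uIoc
    infer_instance
  exact Integrable.of_bound hF.stronglyMeasurable_uncurry.aestronglyMeasurable C
    (ae_of_all _ fun x => hC x.1 x.2)

end BddCont

/-- A family of continuous processes, bounded by `1` and frozen outside `[0, T]`, with linear drift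
`-c p X p dt` and covariations `κ p q (X (D p q) - X (S p q)) dt`. -/
structure IsDriftSystem {I Ω : Type*} {mΩ : MeasurableSpace Ω} (P : Measure Ω) (T : ℝ)
    (𝒜 : Filtration ℝ mΩ) (D S : I → I → I) (κ : I → I → ℝ) (c : I → ℝ)
    (X : I → ℝ → Ω → ℝ) : Prop where
  cont : ∀ p ω, Continuous fun r => X p r ω
  clamp : ∀ p r ω, X p (max 0 (min r T)) ω = X p r ω
  bound : ∀ p r ω, |X p r ω| ≤ 1
  meas : ∀ p t, 0 ≤ t → t ≤ T →
    StronglyMeasurable[𝒜 t] fun ω => X p t ω + c p * ∫ r in (0 : ℝ)..t, X p r ω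
  mart : ∀ p s t, 0 ≤ s → s ≤ t → t ≤ T → ∀ Z, BddMeas (𝒜 s) Z →
    ∫ ω, Z ω * (X p t ω + c p * ∫ r in (0 : ℝ)..t, X p r ω) ∂P
      = ∫ ω, Z ω * (X p s ω + c p * ∫ r in (0 : ℝ)..s, X p r ω) ∂P
  bracket : ∀ p q s t, 0 ≤ s → s ≤ t → t ≤ T → ∀ Z, BddMeas (𝒜 s) Z →
    ∫ ω, Z ω * ((X p t ω + c p * ∫ r in (0 : ℝ)..t, X p r ω)
        * (X q t ω + c q * ∫ r in (0 : ℝ)..t, X q r ω)) ∂P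
      - ∫ ω, Z ω * ((X p s ω + c p * ∫ r in (0 : ℝ)..s, X p r ω)
        * (X q s ω + c q * ∫ r in (0 : ℝ)..s, X q r ω)) ∂P
      = ∫ ω, Z ω * (∫ r in s..t, κ p q * (X (D p q) r ω - X (S p q) r ω)) ∂P

namespace IsDriftSystem

variable {I Ω : Type*} {mΩ : MeasurableSpace Ω} {P : Measure Ω} {T : ℝ}
  {𝒜 : Filtration ℝ mΩ} {D S : I → I → I} {κ : I → I → ℝ} {c : I → ℝ} {X : I → ℝ → Ω → ℝ}

theorem continuous_primitive (h : IsDriftSystem P T 𝒜 D S κ c X) (p : I) (ω : Ω) :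
    Continuous fun t => ∫ r in (0 : ℝ)..t, X p r ω :=
  intervalIntegral.continuous_primitive (fun _ _ => (h.cont p ω).intervalIntegrable _ _) 0

theorem abs_primitive_le (h : IsDriftSystem P T 𝒜 D S κ c X) (p : I) (ω : Ω) {t : ℝ}
    (h0 : 0 ≤ t) (ht : t ≤ T) : |∫ r in (0 : ℝ)..t, X p r ω| ≤ T := by
  have := intervalIntegral.norm_integral_le_of_norm_le_const (f := fun r => X p r ω)
    (a := 0) (b := t) (C := 1) fun r _ => h.bound p r ω
  rw [sub_zero, abs_of_nonneg h0, one_mul] at this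
  exact this.trans ht

theorem bddCont_compensated (h : IsDriftSystem P T 𝒜 D S κ c X) (p : I) {t : ℝ} (h0 : 0 ≤ t)
    (ht : t ≤ T) : BddCont (𝒜 t) fun s ω => X p (max 0 (min s t)) ω
      + c p * ∫ r in (0 : ℝ)..(max 0 (min s t)), X p r ω := by
  have hcl : Continuous fun s : ℝ => max 0 (min s t) := by fun_prop
  refine ⟨fun ω => ?_, fun s => ?_, 1 + |c p| * T, fun s ω => ?_⟩
  · exact ((h.cont p ω).comp hcl).add
      (continuous_const.mul ((h.continuous_primitive p ω).comp hcl))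
  · have h1 : max 0 (min s t) ≤ t := max_le h0 (min_le_right _ _)
    exact (h.meas p _ (le_max_left _ _) (h1.trans ht)).mono (𝒜.mono h1)
  · have h1 : max 0 (min s t) ≤ t := max_le h0 (min_le_right _ _)
    refine (abs_add_le _ _).trans (add_le_add (h.bound _ _ _) ?_)
    rw [abs_mul]
    exact mul_le_mul_of_nonneg_left (h.abs_primitive_le p ω (le_max_left _ _) (h1.trans ht))
      (abs_nonneg _)

theorem primitive_eq (h : IsDriftSystem P T 𝒜 D S κ c X) (p : I) {t : ℝ} (h0 : 0 ≤ t) (ω : Ω) :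
    ∫ r in (0 : ℝ)..t, X p r ω = Real.exp (-(c p * t)) * ∫ s in (0 : ℝ)..t, Real.exp (c p * s)
      * (X p (max 0 (min s t)) ω + c p * ∫ r in (0 : ℝ)..(max 0 (min s t)), X p r ω) := by
  have h1 := exp_mul_sub_eq_integral (u := fun t => ∫ r in (0 : ℝ)..t, X p r ω)
    (v := fun t => X p t ω + c p * ∫ r in (0 : ℝ)..t, X p r ω) (C := c p) h0
    (h.continuous_primitive p ω)
    ((h.cont p ω).add (continuous_const.mul (h.continuous_primitive p ω)))
    (fun r _ => by simp)
  have h2 : ∫ s in (0 : ℝ)..t, Real.exp (c p * s)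
      * (X p (max 0 (min s t)) ω + c p * ∫ r in (0 : ℝ)..(max 0 (min s t)), X p r ω)
      = ∫ s in (0 : ℝ)..t, Real.exp (c p * s) * (X p s ω + c p * ∫ r in (0 : ℝ)..s, X p r ω) := by
    refine intervalIntegral.integral_congr fun s hs => ?_
    rw [uIcc_of_le h0] at hs
    simp only [min_eq_left hs.2, max_eq_right hs.1]
  rw [h2, ← h1]
  simp [← mul_assoc, ← Real.exp_add]

theorem measurable_primitive (h : IsDriftSystem P T 𝒜 D S κ c X) (p : I) {t : ℝ} (h0 : 0 ≤ t)
    (ht : t ≤ T) : StronglyMeasurable[𝒜 t] fun ω => ∫ r in (0 : ℝ)..t, X p r ω := by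
  have hb := h.bddCont_compensated p h0 ht
  simp_rw [h.primitive_eq p h0]
  have hcl : Continuous fun s : ℝ => max 0 (min s t) := by fun_prop
  have hF : BddCont (𝒜 t) fun s ω => Real.exp (c p * max 0 (min s t))
      * (X p (max 0 (min s t)) ω + c p * ∫ r in (0 : ℝ)..(max 0 (min s t)), X p r ω) := by
    refine BddCont.mul ⟨fun _ => by fun_prop, fun _ => stronglyMeasurable_const,
      Real.exp (|c p| * t), fun s _ => ?_⟩ hb
    rw [abs_of_pos (Real.exp_pos _)]
    refine Real.exp_le_exp.2 (mul_le_mul (le_abs_self _) (max_le h0 (min_le_right _ _))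
      (le_max_left _ _) (abs_nonneg _))
  have := (@BddCont.bddMeas_intervalIntegral Ω (𝒜 t) _ hF 0 t).1
  refine StronglyMeasurable.const_mul (mα := 𝒜 t) ?_ _
  convert this using 2 with ω
  refine intervalIntegral.integral_congr fun s hs => ?_
  rw [uIcc_of_le h0] at hs
  simp only [min_eq_left hs.2, max_eq_right hs.1]

theorem measurable (h : IsDriftSystem P T 𝒜 D S κ c X) (p : I) {t : ℝ} (h0 : 0 ≤ t)
    (ht : t ≤ T) : StronglyMeasurable[𝒜 t] (X p t) := by
  have := (h.meas p t h0 ht).sub ((h.measurable_primitive p h0 ht).const_mul (c p))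
  refine (congrArg _ (funext fun ω => ?_)).mp this
  simp

theorem bddMeas (h : IsDriftSystem P T 𝒜 D S κ c X) (p : I) {t : ℝ} (h0 : 0 ≤ t)
    (ht : t ≤ T) : BddMeas (𝒜 t) (X p t) := ⟨h.measurable p h0 ht, 1, h.bound p t⟩

theorem bddMeas_primitive (h : IsDriftSystem P T 𝒜 D S κ c X) (p : I) {t : ℝ} (h0 : 0 ≤ t)
    (ht : t ≤ T) : BddMeas (𝒜 t) fun ω => ∫ r in (0 : ℝ)..t, X p r ω :=
  ⟨h.measurable_primitive p h0 ht, T, fun ω => h.abs_primitive_le p ω h0 ht⟩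

theorem bddCont (h : IsDriftSystem P T 𝒜 D S κ c X) (hT : 0 ≤ T) (p : I) : BddCont mΩ (X p) := by
  refine ⟨h.cont p, fun r => ?_, 1, h.bound p⟩
  have h1 : X p r = X p (max 0 (min r T)) := funext fun ω => (h.clamp p r ω).symm
  rw [h1]
  exact (h.measurable p (le_max_left _ _) (max_le hT (min_le_right _ _))).mono (𝒜.le _)

end IsDriftSystem

namespace IsDriftSystem

variable {I Ω : Type*} {mΩ : MeasurableSpace Ω} {P : Measure Ω} [IsProbabilityMeasure P] {T : ℝ}
  {𝒜 : Filtration ℝ mΩ} {D S : I → I → I} {κ : I → I → ℝ} {c : I → ℝ} {X : I → ℝ → Ω → ℝ}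

theorem integral_mul_eq (h : IsDriftSystem P T 𝒜 D S κ c X) (p : I) {s t : ℝ} (hs : 0 ≤ s)
    (hst : s ≤ t) (ht : t ≤ T) {Z : Ω → ℝ} (hZ : BddMeas (𝒜 s) Z) :
    ∫ ω, Z ω * X p t ω ∂P
      = ∫ ω, Z ω * X p s ω ∂P + ∫ r in s..t, (0 - c p * ∫ ω, Z ω * X p r ω ∂P) := by
  have hT : 0 ≤ T := hs.trans (hst.trans ht)
  have hX := h.bddCont hT p
  have hZ' := hZ.mono (𝒜.le s)
  have hF := (BddCont.const hZ').mul hX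
  have hm := h.mart p s t hs hst ht Z hZ
  have e1 : ∀ t, ∫ ω, Z ω * (X p t ω + c p * ∫ r in (0 : ℝ)..t, X p r ω) ∂P
      = ∫ ω, Z ω * X p t ω ∂P + c p * ∫ r in (0 : ℝ)..t, ∫ ω, Z ω * X p r ω ∂P := fun t => by
    rw [← hF.integral_intervalIntegral, ← integral_const_mul, ← integral_add
      (hF.bddMeas t).integrable
      ((BddMeas.const (c p)).mul (hF.bddMeas_intervalIntegral 0 t)).integrable]
    refine integral_congr_ae (ae_of_all _ fun ω => ?_)
    simp only [intervalIntegral.integral_const_mul]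
    ring
  rw [e1, e1] at hm
  have hc : Continuous fun r => ∫ ω, Z ω * X p r ω ∂P := hF.continuous_integral
  have := intervalIntegral.integral_interval_sub_left (a := 0) (hc.intervalIntegrable 0 t)
    (hc.intervalIntegrable 0 s) (μ := volume)
  simp only [zero_sub, intervalIntegral.integral_neg, intervalIntegral.integral_const_mul]
  rw [← this]
  linarith

theorem exp_mul_integral_mul_eq (h : IsDriftSystem P T 𝒜 D S κ c X) (p : I) {s t : ℝ} (hs : 0 ≤ s)
    (hst : s ≤ t) (ht : t ≤ T) {Z : Ω → ℝ} (hZ : BddMeas (𝒜 s) Z) :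
    Real.exp (c p * t) * ∫ ω, Z ω * X p t ω ∂P
      = Real.exp (c p * s) * ∫ ω, Z ω * X p s ω ∂P := by
  have hT : 0 ≤ T := hs.trans (hst.trans ht)
  have hF := (BddCont.const (hZ.mono (𝒜.le s))).mul (h.bddCont hT p)
  have := exp_mul_sub_eq_integral (u := fun r => ∫ ω, Z ω * X p r ω ∂P) (v := fun _ => 0)
    (C := c p) hst hF.continuous_integral continuous_const
    (fun r hr => h.integral_mul_eq p hs hr.1 (hr.2.trans ht) hZ)
  simp only [mul_zero, intervalIntegral.integral_zero] at this
  linarith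

/-- Integration by parts between a primitive and a compensated process. -/
theorem integral_mul_primitive_mul (h : IsDriftSystem P T 𝒜 D S κ c X) (p q : I) {s t : ℝ}
    (hs : 0 ≤ s) (hst : s ≤ t) (ht : t ≤ T) {Z : Ω → ℝ} (hZ : BddMeas (𝒜 s) Z) :
    ∫ ω, Z ω * ((∫ r in (0 : ℝ)..t, X p r ω) * (X q t ω + c q * ∫ r in (0 : ℝ)..t, X q r ω)) ∂P
      = ∫ ω, Z ω * ((∫ r in (0 : ℝ)..s, X p r ω) * (X q s ω + c q * ∫ r in (0 : ℝ)..s, X q r ω)) ∂P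
      + ∫ r in s..t, ∫ ω, Z ω * (X p r ω * (X q (max 0 (min r t)) ω
        + c q * ∫ r in (0 : ℝ)..(max 0 (min r t)), X q r ω)) ∂P := by
  have h0t := hs.trans hst
  have hsT := hst.trans ht
  have hT : 0 ≤ T := h0t.trans ht
  have hZ' := hZ.mono (𝒜.le s)
  have hX := h.bddCont hT p
  have hws := h.bddMeas_primitive p hs hsT
  have hg : ∀ {r}, 0 ≤ r → r ≤ T →
      BddMeas (𝒜 r) fun ω => X q r ω + c q * ∫ r in (0 : ℝ)..r, X q r ω := fun h0 hr =>
    (h.bddMeas q h0 hr).add ((BddMeas.const _).mul (h.bddMeas_primitive q h0 hr))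
  have hgt := (hg h0t ht).mono (𝒜.le t)
  have h1 := h.mart q s t hs hst ht _ (hZ.mul hws)
  have h2 : ∫ r in s..t, ∫ ω, Z ω * (X p r ω * (X q (max 0 (min r t)) ω
        + c q * ∫ r in (0 : ℝ)..(max 0 (min r t)), X q r ω)) ∂P
      = ∫ r in s..t, ∫ ω, (Z ω * X p r ω) * (X q t ω + c q * ∫ r in (0 : ℝ)..t, X q r ω) ∂P := by
    refine intervalIntegral.integral_congr fun r hr => ?_
    rw [uIcc_of_le hst] at hr
    have h0r := hs.trans hr.1
    have := h.mart q r t h0r hr.2 ht _ ((hZ.mono (𝒜.mono hr.1)).mul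
      (h.bddMeas p h0r (hr.2.trans ht)))
    simp only [min_eq_left hr.2, max_eq_right h0r]
    rw [this]
    simp only [mul_assoc]
  have hF := ((BddCont.const hZ').mul hX).mul (BddCont.const hgt)
  have h3 : ∀ ω, ∫ r in s..t, Z ω * X p r ω * (X q t ω + c q * ∫ r in (0 : ℝ)..t, X q r ω)
      = Z ω * ((∫ r in (0 : ℝ)..t, X p r ω) * (X q t ω + c q * ∫ r in (0 : ℝ)..t, X q r ω))
        - Z ω * (∫ r in (0 : ℝ)..s, X p r ω) * (X q t ω + c q * ∫ r in (0 : ℝ)..t, X q r ω) := by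
    intro ω
    have := intervalIntegral.integral_interval_sub_left (a := 0)
      ((h.cont p ω).intervalIntegrable 0 t) ((h.cont p ω).intervalIntegrable 0 s) (μ := volume)
    rw [intervalIntegral.integral_mul_const, intervalIntegral.integral_const_mul, ← this]
    ring
  rw [h2, ← hF.integral_intervalIntegral]
  simp_rw [h3]
  rw [integral_sub, h1]
  · simp only [mul_assoc]
    ring
  · exact (hZ'.mul (((h.bddMeas_primitive p h0t ht).mono (𝒜.le t)).mul hgt)).integrable
  · exact ((hZ'.mul (hws.mono (𝒜.le s))).mul hgt).integrable

end IsDriftSystem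

theorem integral_linear_combination {f g h k : ℝ → ℝ} (hf : Continuous f) (hg : Continuous g)
    (hh : Continuous h) (hk : Continuous k) (x y z s t : ℝ) :
    ∫ r in s..t, (f r - x * g r - y * h r + z * k r)
      = (∫ r in s..t, f r) - x * (∫ r in s..t, g r) - y * (∫ r in s..t, h r)
        + z * ∫ r in s..t, k r := by
  rw [intervalIntegral.integral_add, intervalIntegral.integral_sub, intervalIntegral.integral_sub,
    intervalIntegral.integral_const_mul, intervalIntegral.integral_const_mul,
    intervalIntegral.integral_const_mul]
  all_goals exact Continuous.intervalIntegrable (by fun_prop) _ _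

namespace IsDriftSystem

variable {I Ω : Type*} {mΩ : MeasurableSpace Ω} {P : Measure Ω} {T : ℝ}
  {𝒜 : Filtration ℝ mΩ} {D S : I → I → I} {κ : I → I → ℝ} {c : I → ℝ} {X : I → ℝ → Ω → ℝ}

theorem bddCont_primitive (h : IsDriftSystem P T 𝒜 D S κ c X) (p : I) {t : ℝ} (h0 : 0 ≤ t)
    (ht : t ≤ T) : BddCont mΩ fun r ω => ∫ x in (0 : ℝ)..(max 0 (min r t)), X p x ω := by
  have h1 : ∀ r, max 0 (min r t) ≤ T := fun r => max_le (h0.trans ht) ((min_le_right _ _).trans ht)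
  refine ⟨fun ω => (h.continuous_primitive p ω).comp (by fun_prop), fun r => ?_, T, fun r ω => ?_⟩
  · exact (h.measurable_primitive p (le_max_left _ _) (h1 r)).mono (𝒜.le _)
  · exact h.abs_primitive_le p ω (le_max_left _ _) (h1 r)

theorem primitive_mul_primitive (h : IsDriftSystem P T 𝒜 D S κ c X) (p q : I) {s t : ℝ}
    (hs : 0 ≤ s) (hst : s ≤ t) (ω : Ω) :
    (∫ r in (0 : ℝ)..t, X p r ω) * (∫ r in (0 : ℝ)..t, X q r ω)
      = (∫ r in (0 : ℝ)..s, X p r ω) * (∫ r in (0 : ℝ)..s, X q r ω)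
        + ∫ r in s..t, (X p r ω * (∫ x in (0 : ℝ)..(max 0 (min r t)), X q x ω)
          + X q r ω * (∫ x in (0 : ℝ)..(max 0 (min r t)), X p x ω)) := by
  have hd : ∀ p r, HasDerivAt (fun r => ∫ x in (0 : ℝ)..r, X p x ω) (X p r ω) r := fun p r =>
    intervalIntegral.integral_hasDerivAt_right ((h.cont p ω).intervalIntegrable _ _)
      ((h.cont p ω).stronglyMeasurableAtFilter _ _) (h.cont p ω).continuousAt
  have h1 := intervalIntegral.integral_deriv_mul_eq_sub (a := s) (b := t)
    (fun r _ => hd p r) (fun r _ => hd q r) ((h.cont p ω).intervalIntegrable _ _)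
    ((h.cont q ω).intervalIntegrable _ _)
  have h2 : ∫ r in s..t, (X p r ω * (∫ x in (0 : ℝ)..(max 0 (min r t)), X q x ω)
          + X q r ω * (∫ x in (0 : ℝ)..(max 0 (min r t)), X p x ω))
      = ∫ r in s..t, (X p r ω * (∫ x in (0 : ℝ)..r, X q x ω)
          + (∫ x in (0 : ℝ)..r, X p x ω) * X q r ω) := by
    refine intervalIntegral.integral_congr fun r hr => ?_
    rw [uIcc_of_le hst] at hr
    simp only [min_eq_left hr.2, max_eq_right (hs.trans hr.1)]
    ring
  rw [h2, h1]
  ring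

variable [IsProbabilityMeasure P]

theorem integral_mul_mul_expand (h : IsDriftSystem P T 𝒜 D S κ c X) (p q : I) {t : ℝ}
    (h0 : 0 ≤ t) (ht : t ≤ T) {Z : Ω → ℝ} (hZ : BddMeas mΩ Z) :
    ∫ ω, Z ω * (X p t ω * X q t ω) ∂P
      = ∫ ω, Z ω * ((X p t ω + c p * ∫ r in (0 : ℝ)..t, X p r ω)
          * (X q t ω + c q * ∫ r in (0 : ℝ)..t, X q r ω)) ∂P
        - c p * ∫ ω, Z ω * ((∫ r in (0 : ℝ)..t, X p r ω)
          * (X q t ω + c q * ∫ r in (0 : ℝ)..t, X q r ω)) ∂P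
        - c q * ∫ ω, Z ω * ((∫ r in (0 : ℝ)..t, X q r ω)
          * (X p t ω + c p * ∫ r in (0 : ℝ)..t, X p r ω)) ∂P
        + c p * c q * ∫ ω, Z ω * ((∫ r in (0 : ℝ)..t, X p r ω)
          * (∫ r in (0 : ℝ)..t, X q r ω)) ∂P := by
  have hx := fun p => (h.bddMeas p h0 ht).mono (𝒜.le t)
  have hw := fun p => (h.bddMeas_primitive p h0 ht).mono (𝒜.le t)
  have hg := fun p => (hx p).add ((BddMeas.const (c p)).mul (hw p))
  have i1 := hZ.mul ((hg p).mul (hg q))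
  have i2 := (BddMeas.const (c p)).mul (hZ.mul ((hw p).mul (hg q)))
  have i3 := (BddMeas.const (c q)).mul (hZ.mul ((hw q).mul (hg p)))
  have i4 := (BddMeas.const (c p * c q)).mul (hZ.mul ((hw p).mul (hw q)))
  rw [← integral_const_mul, ← integral_const_mul, ← integral_const_mul,
    ← integral_sub i1.integrable i2.integrable, ← integral_sub (i1.sub i2).integrable i3.integrable,
    ← integral_add ((i1.sub i2).sub i3).integrable i4.integrable]
  refine integral_congr_ae (ae_of_all _ fun ω => ?_)
  ring

theorem integral_mul_mul_eq (h : IsDriftSystem P T 𝒜 D S κ c X) (p q : I) {s t : ℝ} (hs : 0 ≤ s)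
    (hst : s ≤ t) (ht : t ≤ T) {Z : Ω → ℝ} (hZ : BddMeas (𝒜 s) Z) :
    ∫ ω, Z ω * (X p t ω * X q t ω) ∂P
      = ∫ ω, Z ω * (X p s ω * X q s ω) ∂P
        + ∫ r in s..t, ((κ p q * ∫ ω, Z ω * X (D p q) r ω ∂P
          - κ p q * ∫ ω, Z ω * X (S p q) r ω ∂P)
            - (c p + c q) * ∫ ω, Z ω * (X p r ω * X q r ω) ∂P) := by
  have h0t := hs.trans hst
  have hT : 0 ≤ T := h0t.trans ht
  have hZ' := hZ.mono (𝒜.le s)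
  have hZc := BddCont.const hZ'
  have hX := fun p => h.bddCont hT p
  have hW := fun p => h.bddCont_primitive p h0t ht
  have hG := fun p => (h.bddCont_compensated p h0t ht).mono (𝒜.le t)
  have hKD := hZc.mul (hX (D p q))
  have hKS := hZc.mul (hX (S p q))
  have hK := hZc.mul (((hX (D p q)).sub (hX (S p q))).const_mul (κ p q))
  have hA := hZc.mul ((hX p).mul (hG q))
  have hB := hZc.mul ((hX q).mul (hG p))
  have hC := hZc.mul (((hX p).mul (hW q)).add ((hX q).mul (hW p)))
  have eK : ∫ ω, Z ω * (∫ r in s..t, κ p q * (X (D p q) r ω - X (S p q) r ω)) ∂P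
      = ∫ r in s..t, ∫ ω, Z ω * (κ p q * (X (D p q) r ω - X (S p q) r ω)) ∂P := by
    rw [← hK.integral_intervalIntegral]
    simp only [intervalIntegral.integral_const_mul]
  have eC : ∫ ω, Z ω * ((∫ r in (0 : ℝ)..t, X p r ω) * (∫ r in (0 : ℝ)..t, X q r ω)) ∂P
      = ∫ ω, Z ω * ((∫ r in (0 : ℝ)..s, X p r ω) * (∫ r in (0 : ℝ)..s, X q r ω)) ∂P
        + ∫ r in s..t, ∫ ω, Z ω * (X p r ω * (∫ x in (0 : ℝ)..(max 0 (min r t)), X q x ω)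
          + X q r ω * (∫ x in (0 : ℝ)..(max 0 (min r t)), X p x ω)) ∂P := by
    have hw := fun p => (h.bddMeas_primitive p hs (hst.trans ht)).mono (𝒜.le s)
    rw [← hC.integral_intervalIntegral, ← integral_add (hZ'.mul ((hw p).mul (hw q))).integrable
      (hC.bddMeas_intervalIntegral s t).integrable]
    refine integral_congr_ae (ae_of_all _ fun ω => ?_)
    simp only
    rw [h.primitive_mul_primitive p q hs hst, intervalIntegral.integral_const_mul]
    ring
  have eG := h.bracket p q s t hs hst ht Z hZ
  have eA := h.integral_mul_primitive_mul p q hs hst ht hZ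
  have eB := h.integral_mul_primitive_mul q p hs hst ht hZ
  have key : ∫ r in s..t, ((κ p q * ∫ ω, Z ω * X (D p q) r ω ∂P
          - κ p q * ∫ ω, Z ω * X (S p q) r ω ∂P)
            - (c p + c q) * ∫ ω, Z ω * (X p r ω * X q r ω) ∂P)
      = ((∫ r in s..t, ∫ ω, Z ω * (κ p q * (X (D p q) r ω - X (S p q) r ω)) ∂P)
        - c p * (∫ r in s..t, ∫ ω, Z ω * (X p r ω * (X q (max 0 (min r t)) ω
        + c q * ∫ r in (0 : ℝ)..(max 0 (min r t)), X q r ω)) ∂P)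
        - c q * (∫ r in s..t, ∫ ω, Z ω * (X q r ω * (X p (max 0 (min r t)) ω
        + c p * ∫ r in (0 : ℝ)..(max 0 (min r t)), X p r ω)) ∂P))
        + c p * c q * (∫ r in s..t, ∫ ω, Z ω * (X p r ω
          * (∫ x in (0 : ℝ)..(max 0 (min r t)), X q x ω)
          + X q r ω * (∫ x in (0 : ℝ)..(max 0 (min r t)), X p x ω)) ∂P) := by
    rw [← integral_linear_combination hK.continuous_integral hA.continuous_integral
      hB.continuous_integral hC.continuous_integral]
    refine intervalIntegral.integral_congr fun r hr => ?_
    rw [uIcc_of_le hst] at hr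
    have k1 := (hKD.const_mul (κ p q)).bddMeas r
    have k2 := (hKS.const_mul (κ p q)).bddMeas r
    have k3 := ((hZc.mul ((hX p).mul (hX q))).const_mul (c p + c q)).bddMeas r
    have k4 := hK.bddMeas r
    have k5 := (hA.const_mul (c p)).bddMeas r
    have k6 := (hB.const_mul (c q)).bddMeas r
    have k7 := (hC.const_mul (c p * c q)).bddMeas r
    simp only [← integral_const_mul]
    rw [← integral_sub k1.integrable k2.integrable, ← integral_sub (k1.sub k2).integrable
      k3.integrable, ← integral_sub k4.integrable k5.integrable, ← integral_sub
      (k4.sub k5).integrable k6.integrable, ← integral_add ((k4.sub k5).sub k6).integrable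
      k7.integrable]
    refine integral_congr_ae (ae_of_all _ fun ω => ?_)
    simp only [min_eq_left hr.2, max_eq_right (hs.trans hr.1)]
    ring
  rw [h.integral_mul_mul_expand p q h0t ht hZ',
    h.integral_mul_mul_expand p q hs (hst.trans ht) hZ', key]
  rw [eK] at eG
  rw [eA, eB, eC]
  linear_combination eG

theorem integral_exp_le (k s t : ℝ) (T : ℝ) (hs : 0 ≤ s) (hst : s ≤ t) (ht : t ≤ T) :
    |∫ r in s..t, Real.exp (k * r)| ≤ Real.exp (|k| * T) * (t - s) := by
  have := intervalIntegral.norm_integral_le_of_norm_le_const (f := fun r => Real.exp (k * r))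
    (a := s) (b := t) (C := Real.exp (|k| * T)) fun r hr => by
      rw [uIoc_of_le hst] at hr
      rw [Real.norm_eq_abs, abs_of_pos (Real.exp_pos _)]
      exact Real.exp_le_exp.2 (mul_le_mul (le_abs_self _) (hr.2.trans ht) (hs.trans hr.1.le)
        (abs_nonneg _))
  rwa [abs_of_nonneg (sub_nonneg.2 hst)] at this

theorem isMomentSystem (h : IsDriftSystem P T 𝒜 D S κ c X) :
    IsMomentSystem P T 𝒜 D S
      (fun p q s t => κ p q * ∫ r in s..t, Real.exp ((c p + c q - c (D p q)) * r))
      (fun p q s t => -κ p q * ∫ r in s..t, Real.exp ((c p + c q - c (S p q)) * r))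
      (fun p t ω => Real.exp (c p * t) * X p t ω) where
  meas p t h0 ht := (h.measurable p h0 ht).const_mul _
  bound p := ⟨Real.exp (|c p| * T), fun t h0 ht ω => by
    rw [abs_mul, abs_of_pos (Real.exp_pos _), ← mul_one (Real.exp (|c p| * T))]
    exact mul_le_mul (Real.exp_le_exp.2 (mul_le_mul (le_abs_self _) ht h0 (abs_nonneg _)))
      (h.bound p t ω) (abs_nonneg _) (Real.exp_pos _).le⟩
  cont p ω := by
    have := h.cont p ω
    exact Continuous.continuousOn (by fun_prop)
  mart p s t hs hst ht Z hZ := by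
    simp only [mul_left_comm (Z _), integral_const_mul]
    exact h.exp_mul_integral_mul_eq p hs hst ht hZ
  bracket p q s t hs hst ht Z hZ := by
    have hT : 0 ≤ T := hs.trans (hst.trans ht)
    have hZc := BddCont.const (hZ.mono (𝒜.le s))
    have hX := fun p => h.bddCont hT p
    have hU : Continuous fun r => ∫ ω, Z ω * (X p r ω * X q r ω) ∂P :=
      (hZc.mul ((hX p).mul (hX q))).continuous_integral
    have hV : ∀ q, Continuous fun r => ∫ ω, Z ω * X q r ω ∂P := fun q =>
      (hZc.mul (hX q)).continuous_integral
    have h1 := exp_mul_sub_eq_integral (u := fun r => ∫ ω, Z ω * (X p r ω * X q r ω) ∂P)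
      (v := fun r => κ p q * ∫ ω, Z ω * X (D p q) r ω ∂P - κ p q * ∫ ω, Z ω * X (S p q) r ω ∂P)
      (C := c p + c q) hst hU ((continuous_const.mul (hV _)).sub (continuous_const.mul (hV _)))
      (fun r hr => h.integral_mul_mul_eq p q hs hr.1 (hr.2.trans ht) hZ)
    have e1 : ∀ t, ∫ ω, Z ω * (Real.exp (c p * t) * X p t ω * (Real.exp (c q * t) * X q t ω)) ∂P
        = Real.exp ((c p + c q) * t) * ∫ ω, Z ω * (X p t ω * X q t ω) ∂P := fun t => by
      rw [← integral_const_mul, add_mul, Real.exp_add]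
      refine integral_congr_ae (ae_of_all _ fun ω => ?_)
      ring
    have e2 : ∀ q, ∀ r ∈ Icc s t, ∫ ω, Z ω * X q r ω ∂P
        = Real.exp (-(c q * r)) * ∫ ω, Z ω * (Real.exp (c q * s) * X q s ω) ∂P := fun q r hr => by
      simp only [mul_left_comm (Z _), integral_const_mul]
      rw [← h.exp_mul_integral_mul_eq q hs hr.1 (hr.2.trans ht) hZ, ← mul_assoc, ← Real.exp_add,
        neg_add_cancel, Real.exp_zero, one_mul]
    rw [e1, e1, h1, mul_right_comm, mul_right_comm (-κ p q),
      ← intervalIntegral.integral_const_mul, ← intervalIntegral.integral_const_mul,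
      ← intervalIntegral.integral_add (Continuous.intervalIntegrable (by fun_prop) _ _)
        (Continuous.intervalIntegrable (by fun_prop) _ _)]
    refine intervalIntegral.integral_congr fun r hr => ?_
    rw [uIcc_of_le hst] at hr
    simp only [e2 _ r hr, sub_mul, Real.exp_sub, Real.exp_neg]
    ring
  coeff p q := by
    set k₁ := c p + c q - c (D p q)
    set k₂ := c p + c q - c (S p q)
    refine ⟨|κ p q| * (Real.exp (|k₁| * T) + Real.exp (|k₂| * T)), fun s t hs hst ht => ?_⟩
    have h1 := integral_exp_le k₁ s t T hs hst ht
    have h2 := integral_exp_le k₂ s t T hs hst ht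
    have hd := sub_nonneg.2 hst
    rw [abs_mul, abs_mul, abs_neg, mul_assoc]
    constructor
    · refine mul_le_mul_of_nonneg_left (h1.trans ?_) (abs_nonneg _)
      gcongr
      exact le_add_of_nonneg_right (Real.exp_pos _).le
    · refine mul_le_mul_of_nonneg_left (h2.trans ?_) (abs_nonneg _)
      gcongr
      exact le_add_of_nonneg_left (Real.exp_pos _).le

end IsDriftSystem

/-- A bounded martingale on `[0, T]`, tested against bounded functions of the past. -/
structure BddMart {Ω : Type*} {mΩ : MeasurableSpace Ω} (P : Measure Ω) (T : ℝ)
    (𝒜 : Filtration ℝ mΩ) (F : ℝ → Ω → ℝ) : Prop where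
  bddMeas : ∀ t, 0 ≤ t → t ≤ T → BddMeas (𝒜 t) (F t)
  mart : ∀ s t, 0 ≤ s → s ≤ t → t ≤ T → ∀ Z, BddMeas (𝒜 s) Z →
    ∫ ω, Z ω * F t ω ∂P = ∫ ω, Z ω * F s ω ∂P

namespace BddMart

variable {Ω : Type*} {mΩ : MeasurableSpace Ω} {P : Measure Ω} {T : ℝ}
  {𝒜 : Filtration ℝ mΩ} {F G : ℝ → Ω → ℝ}

theorem const (k : ℝ) : BddMart P T 𝒜 fun _ _ => k :=
  ⟨fun _ _ _ => BddMeas.const k, fun _ _ _ _ _ _ _ => rfl⟩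

theorem const_mul (hF : BddMart P T 𝒜 F) (k : ℝ) : BddMart P T 𝒜 fun t ω => k * F t ω := by
  refine ⟨fun t h0 ht => (BddMeas.const k).mul (hF.bddMeas t h0 ht),
    fun s t hs hst ht Z hZ => ?_⟩
  simp only [mul_left_comm (Z _), integral_const_mul, hF.mart s t hs hst ht Z hZ]

variable [IsProbabilityMeasure P]

theorem add (hF : BddMart P T 𝒜 F) (hG : BddMart P T 𝒜 G) :
    BddMart P T 𝒜 fun t ω => F t ω + G t ω := by
  refine ⟨fun t h0 ht => (hF.bddMeas t h0 ht).add (hG.bddMeas t h0 ht),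
    fun s t hs hst ht Z hZ => ?_⟩
  have hi : ∀ {H : ℝ → Ω → ℝ}, BddMart P T 𝒜 H → ∀ r, 0 ≤ r → r ≤ T →
      Integrable (fun ω => Z ω * H r ω) P := fun hH r h0 hr =>
    ((hZ.mono (𝒜.le s)).mul ((hH.bddMeas r h0 hr).mono (𝒜.le r))).integrable
  simp only [mul_add]
  rw [integral_add (hi hF t (hs.trans hst) ht) (hi hG t (hs.trans hst) ht),
    integral_add (hi hF s hs (hst.trans ht)) (hi hG s hs (hst.trans ht)),
    hF.mart s t hs hst ht Z hZ, hG.mart s t hs hst ht Z hZ]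

theorem of_tendsto {F : ℕ → ℝ → Ω → ℝ} (hF : ∀ n, BddMart P T 𝒜 (F n)) {C : ℝ}
    (hC : ∀ n t, 0 ≤ t → t ≤ T → ∀ ω, |F n t ω| ≤ C)
    (hG : ∀ t, 0 ≤ t → t ≤ T → ∀ ω, Tendsto (fun n => F n t ω) atTop (nhds (G t ω))) :
    BddMart P T 𝒜 G := by
  refine ⟨fun t h0 ht => ⟨?_, C, fun ω => ?_⟩, fun s t hs hst ht Z hZ => ?_⟩
  · exact stronglyMeasurable_of_tendsto atTop (fun n => ((hF n).bddMeas t h0 ht).1)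
      (tendsto_pi_nhds.2 fun ω => hG t h0 ht ω)
  · exact le_of_tendsto (hG t h0 ht ω).abs (Eventually.of_forall fun n => hC n t h0 ht ω)
  · obtain ⟨hZm, K, hK⟩ := hZ.mono (𝒜.le s)
    have key : ∀ r, 0 ≤ r → r ≤ T → Tendsto (fun n => ∫ ω, Z ω * F n r ω ∂P) atTop
        (nhds (∫ ω, Z ω * G r ω ∂P)) := fun r h0 hr => by
      refine tendsto_integral_of_dominated_convergence (fun _ => K * C)
        (fun n => (hZm.mul (((hF n).bddMeas r h0 hr).1.mono (𝒜.le r))).aestronglyMeasurable)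
        (integrable_const _) (fun n => ae_of_all _ fun ω => ?_)
        (ae_of_all _ fun ω => (hG r h0 hr ω).const_mul _)
      rw [norm_mul]
      exact mul_le_mul (hK ω) (hC n r h0 hr ω) (norm_nonneg _) ((abs_nonneg _).trans (hK ω))
    refine tendsto_nhds_unique (key t (hs.trans hst) ht) ?_
    refine (key s hs (hst.trans ht)).congr fun n => ?_
    exact ((hF n).mart s t hs hst ht Z hZ).symm

end BddMart

/-- The filtration enlarged by all measurable sets that agree almost surely with a set in it. -/
def aeFiltration {Ω : Type*} {mΩ : MeasurableSpace Ω} (ℱ : Filtration ℝ mΩ) (P : Measure Ω) :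
    Filtration ℝ mΩ where
  seq t := eventuallyMeasurableSpace (ℱ t) (ae P) ⊓ mΩ
  mono' s t hst A hA := by
    obtain ⟨⟨B, hB, hAB⟩, hA'⟩ := MeasurableSpace.measurableSet_inf.1 hA
    exact MeasurableSpace.measurableSet_inf.2 ⟨⟨B, ℱ.mono hst B hB, hAB⟩, hA'⟩
  le' _ := inf_le_right

theorem le_aeFiltration {Ω : Type*} {mΩ : MeasurableSpace Ω} (ℱ : Filtration ℝ mΩ) (P : Measure Ω)
    (t : ℝ) : ℱ t ≤ aeFiltration ℱ P t :=
  le_inf le_eventuallyMeasurableSpace (ℱ.le t)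

theorem measurableSet_aeFiltration_of_null {Ω : Type*} {mΩ : MeasurableSpace Ω}
    {ℱ : Filtration ℝ mΩ} {P : Measure Ω} {N : Set Ω} (hN : MeasurableSet N) (h0 : P N = 0)
    (t : ℝ) : MeasurableSet[aeFiltration ℱ P t] N :=
  MeasurableSpace.measurableSet_inf.2 ⟨⟨∅, @MeasurableSet.empty _ (ℱ t), ae_eq_empty.2 h0⟩, hN⟩

/-- A bounded martingale, made deterministic on a null set. -/
theorem MartingaleOn.bddMart {Ω : Type*} {mΩ : MeasurableSpace Ω} {ℱ : Filtration ℝ mΩ}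
    {P : Measure Ω} [IsProbabilityMeasure P] {T : ℝ} {X Y : ℝ → Ω → ℝ} (hX : MartingaleOn X ℱ P T)
    {C : ℝ} (hC : ∀ t, 0 ≤ t → t ≤ T → ∀ ω, |Y t ω| ≤ C) {N : Set Ω} (hN : MeasurableSet N)
    (hN0 : P N = 0) (hXY : ∀ t, 0 ≤ t → t ≤ T → ∀ ω ∉ N, Y t ω = X t ω) {k : ℝ → ℝ}
    (hk : ∀ t, 0 ≤ t → t ≤ T → ∀ ω ∈ N, Y t ω = k t) :
    BddMart P T (aeFiltration ℱ P) Y := by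
  classical
  have hb : ∀ t, 0 ≤ t → t ≤ T → BddMeas (aeFiltration ℱ P t) (Y t) := fun t h0 ht => by
    refine ⟨?_, C, hC t h0 ht⟩
    have : Y t = N.piecewise (fun _ => k t) (X t) := by
      funext ω
      by_cases hω : ω ∈ N
      · rw [piecewise_eq_of_mem _ _ _ hω, hk t h0 ht ω hω]
      · rw [piecewise_eq_of_notMem _ _ _ hω, hXY t h0 ht ω hω]
    rw [this]
    exact StronglyMeasurable.piecewise (measurableSet_aeFiltration_of_null hN hN0 t)
      stronglyMeasurable_const ((hX.1 t h0 ht).mono (le_aeFiltration ℱ P t))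
  have hae : ∀ t, 0 ≤ t → t ≤ T → Y t =ᵐ[P] X t := fun t h0 ht => by
    filter_upwards [measure_eq_zero_iff_ae_notMem.1 hN0] with ω hω using hXY t h0 ht ω hω
  refine ⟨hb, fun s t hs hst ht Z hZ => ?_⟩
  have h0t := hs.trans hst
  have hsT := hst.trans ht
  have hYt : Integrable (Y t) P := ((hb t h0t ht).mono ((aeFiltration ℱ P).le t)).integrable
  have hYs : Integrable (Y s) P := ((hb s hs hsT).mono ((aeFiltration ℱ P).le s)).integrable
  have hce : P[Y t | ℱ s] =ᵐ[P] Y s :=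
    (condExp_congr_ae (hae t h0t ht)).trans ((hX.2 s t hs hst ht).trans (hae s hs hsT).symm)
  have hce' : Y s =ᵐ[P] P[Y t | aeFiltration ℱ P s] := by
    refine ae_eq_condExp_of_forall_setIntegral_eq ((aeFiltration ℱ P).le s) hYt
      (fun _ _ _ => hYs.integrableOn) (fun A hA _ => ?_) (hb s hs hsT).1.aestronglyMeasurable
    obtain ⟨⟨B, hB, hAB⟩, -⟩ := MeasurableSpace.measurableSet_inf.1 hA
    have hAB : A =ᵐ[P] B := hAB
    rw [setIntegral_congr_set hAB, setIntegral_congr_set hAB,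
      ← setIntegral_condExp (ℱ.le s) hYt hB]
    exact setIntegral_congr_ae (ℱ.le s B hB) (by filter_upwards [hce] with ω h _ using h.symm)
  obtain ⟨hZm, K, hK⟩ := hZ
  have h1 := condExp_stronglyMeasurable_mul_of_bound ((aeFiltration ℱ P).le s) hZm hYt K
    (ae_of_all _ hK)
  calc ∫ ω, Z ω * Y t ω ∂P = ∫ ω, (P[Z * Y t | aeFiltration ℱ P s]) ω ∂P :=
        (integral_condExp ((aeFiltration ℱ P).le s)).symm
    _ = ∫ ω, Z ω * Y s ω ∂P := by
        refine integral_congr_ae ?_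
        filter_upwards [h1, hce'] with ω h1 h2
        rw [h1, Pi.mul_apply, h2]

theorem natCast_le_infty (i : ℕ) : (i : WithTop ℕ∞) ≤ ((⊤ : ℕ∞) : WithTop ℕ∞) := by
  exact_mod_cast le_top

/-- Smooth functions with all derivatives bounded. -/
structure IsBddSmooth {E : Type*} [NormedAddCommGroup E] [NormedSpace ℝ E] (φ : E → ℝ) : Prop where
  contDiff : ContDiff ℝ (⊤ : ℕ∞) φ
  bound : ∀ i : ℕ, ∃ C, ∀ x, ‖iteratedFDeriv ℝ i φ x‖ ≤ C

namespace IsBddSmooth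

variable {E F : Type*} [NormedAddCommGroup E] [NormedSpace ℝ E] [NormedAddCommGroup F]
  [NormedSpace ℝ F] {φ ψ : E → ℝ}

theorem norm_iteratedFDeriv_comp_clm_le {f : F → ℝ} (hf : ContDiff ℝ (⊤ : ℕ∞) f) (g : E →L[ℝ] F)
    (i : ℕ) (x : E) :
    ‖iteratedFDeriv ℝ i (f ∘ g) x‖ ≤ ‖iteratedFDeriv ℝ i f (g x)‖ * ‖g‖ ^ i := by
  rw [g.iteratedFDeriv_comp_right hf x (i := i) (natCast_le_infty i)]
  refine (ContinuousMultilinearMap.norm_compContinuousLinearMap_le _ _).trans ?_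
  simp

theorem comp_clm {f : F → ℝ} (hf : IsBddSmooth f) (g : E →L[ℝ] F) : IsBddSmooth (f ∘ g) := by
  refine ⟨hf.contDiff.comp g.contDiff, fun i => ?_⟩
  obtain ⟨C, hC⟩ := hf.bound i
  exact ⟨C * ‖g‖ ^ i, fun x => (norm_iteratedFDeriv_comp_clm_le hf.contDiff g i x).trans
    (mul_le_mul_of_nonneg_right (hC _) (by positivity))⟩

theorem add (hφ : IsBddSmooth φ) (hψ : IsBddSmooth ψ) : IsBddSmooth (φ + ψ) := by
  refine ⟨hφ.contDiff.add hψ.contDiff, fun i => ?_⟩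
  obtain ⟨C, hC⟩ := hφ.bound i
  obtain ⟨D, hD⟩ := hψ.bound i
  refine ⟨C + D, fun x => ?_⟩
  have hi := natCast_le_infty i
  rw [iteratedFDeriv_add_apply ((hφ.contDiff.of_le hi).contDiffAt)
    ((hψ.contDiff.of_le hi).contDiffAt)]
  exact (norm_add_le _ _).trans (add_le_add (hC x) (hD x))

theorem of_hasCompactSupport (h : ContDiff ℝ (⊤ : ℕ∞) φ) (hc : HasCompactSupport φ) :
    IsBddSmooth φ := by
  refine ⟨h, fun i => ?_⟩
  exact (hc.iteratedFDeriv i).exists_bound_of_continuous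
    (h.continuous_iteratedFDeriv (natCast_le_infty i))

theorem cos_add (θ : ℝ) : IsBddSmooth fun x : ℝ => Real.cos (x + θ) := by
  refine ⟨Real.contDiff_cos.comp (contDiff_id.add contDiff_const), fun i => ⟨1, fun x => ?_⟩⟩
  rw [norm_iteratedFDeriv_eq_norm_iteratedDeriv, iteratedDeriv_comp_add_const]
  exact Real.abs_iteratedDeriv_cos_le_one i _

theorem exists_bound (h : IsBddSmooth φ) : ∃ C, ∀ x, |φ x| ≤ C := by
  obtain ⟨C, hC⟩ := h.bound 0
  exact ⟨C, fun x => by simpa using hC x⟩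

variable [FiniteDimensional ℝ E]

/-- Bounded smooth functions are limits of compactly supported smooth functions which are
eventually equal to them near every point, with uniformly bounded derivatives. -/
theorem exists_approx [HasContDiffBump E] (h : IsBddSmooth φ) :
    ∃ φ' : ℕ → E → ℝ, (∀ n, ContDiff ℝ (⊤ : ℕ∞) (φ' n)) ∧ (∀ n, HasCompactSupport (φ' n)) ∧
      (∀ x, ∀ᶠ n in atTop, φ' n =ᶠ[nhds x] φ) ∧
      ∀ i : ℕ, ∃ C, ∀ n x, ‖iteratedFDeriv ℝ i (φ' n) x‖ ≤ C := by
  let χ : ContDiffBump (0 : E) := ⟨1, 2, one_pos, one_lt_two⟩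
  have hχ : IsBddSmooth χ := of_hasCompactSupport χ.contDiff χ.hasCompactSupport
  let g : ℕ → E →L[ℝ] E := fun n => ((n : ℝ) + 1)⁻¹ • ContinuousLinearMap.id ℝ E
  have hpos : ∀ n : ℕ, 0 < (n : ℝ) + 1 := fun n => by positivity
  have hg : ∀ n, ‖g n‖ ≤ 1 := fun n => by
    refine (norm_smul_le ((n : ℝ) + 1)⁻¹ (ContinuousLinearMap.id ℝ E)).trans ?_
    rw [norm_inv, Real.norm_of_nonneg (hpos n).le]
    have h1 : ((n : ℝ) + 1)⁻¹ ≤ 1 := inv_le_one_of_one_le₀ (by linarith [n.cast_nonneg (α := ℝ)])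
    have h2 := ContinuousLinearMap.norm_id_le (𝕜 := ℝ) (E := E)
    have h3 : 0 ≤ ((n : ℝ) + 1)⁻¹ := (inv_pos.2 (hpos n)).le
    calc _ ≤ 1 * 1 := mul_le_mul h1 h2 (norm_nonneg _) zero_le_one
      _ = 1 := one_mul 1
  have hχn : ∀ n, ContDiff ℝ (⊤ : ℕ∞) (χ ∘ g n) := fun n => χ.contDiff.comp (g n).contDiff
  refine ⟨fun n x => (χ ∘ g n) x * φ x, fun n => (hχn n).mul h.contDiff, fun n => ?_, fun x => ?_,
    fun i => ?_⟩
  · refine HasCompactSupport.mul_right ?_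
    have := χ.hasCompactSupport.comp_smul (inv_pos.2 (hpos n)).ne'
    simpa [Function.comp_def, g] using this
  · filter_upwards [eventually_gt_atTop ⌈‖x‖⌉₊] with n hn
    have hx : g n x ∈ Metric.ball (0 : E) χ.rIn := by
      rw [mem_ball_zero_iff]
      change ‖((n : ℝ) + 1)⁻¹ • x‖ < 1
      rw [norm_smul, norm_inv, Real.norm_of_nonneg (hpos n).le, inv_mul_lt_iff₀ (hpos n), mul_one]
      have := Nat.lt_of_ceil_lt hn
      linarith
    have h1 := (g n).continuous.continuousAt.eventually (χ.eventuallyEq_one_of_mem_ball hx)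
    filter_upwards [h1] with y hy
    simp [Function.comp_apply, hy]
  · choose C hC using hχ.bound
    choose D hD using h.bound
    refine ⟨∑ j ∈ Finset.range (i + 1), (i.choose j : ℝ) * C j * D (i - j), fun n x => ?_⟩
    refine (norm_iteratedFDeriv_mul_le (hχn n) h.contDiff x (n := i)
      (natCast_le_infty i)).trans (Finset.sum_le_sum fun j _ => ?_)
    have h1 : ‖iteratedFDeriv ℝ j (χ ∘ g n) x‖ ≤ C j := by
      refine (norm_iteratedFDeriv_comp_clm_le χ.contDiff (g n) j x).trans ?_
      calc _ ≤ C j * 1 := mul_le_mul (hC j _) (pow_le_one₀ (norm_nonneg _) (hg n))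
            (by positivity) ((norm_nonneg _).trans (hC j 0))
        _ = C j := mul_one _
    gcongr
    · exact mul_nonneg (by positivity) ((norm_nonneg _).trans (hC j 0))
    · exact hD _ x

end IsBddSmooth

section Operators

variable {d : ℕ} {φ ψ : EuclideanSpace ℝ (Fin d) → ℝ} {x : EuclideanSpace ℝ (Fin d)}

theorem laplacian_congr (h : φ =ᶠ[nhds x] ψ) : laplacian φ x = laplacian ψ x := by
  unfold laplacian
  refine Finset.sum_congr rfl fun i _ => ?_
  have h1 : (fun y => fderiv ℝ φ y (EuclideanSpace.single i 1))
      =ᶠ[nhds x] fun y => fderiv ℝ ψ y (EuclideanSpace.single i 1) := by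
    filter_upwards [h.fderiv (𝕜 := ℝ)] with y hy
    rw [hy]
  rw [h1.fderiv_eq]

theorem norm_gradient_eq (φ : EuclideanSpace ℝ (Fin d) → ℝ) (x : EuclideanSpace ℝ (Fin d)) :
    ‖gradient φ x‖ = ‖fderiv ℝ φ x‖ := by
  simp [gradient]

theorem gradSq_congr (h : φ =ᶠ[nhds x] ψ) : gradSq φ x = gradSq ψ x := by
  simp only [gradSq, norm_gradient_eq, h.fderiv_eq]

theorem laplacian_eq (h : ContDiff ℝ (⊤ : ℕ∞) φ) (x : EuclideanSpace ℝ (Fin d)) :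
    laplacian φ x = ∑ i : Fin d, iteratedFDeriv ℝ 2 φ x
      ![EuclideanSpace.single i 1, EuclideanSpace.single i 1] := by
  unfold laplacian
  refine Finset.sum_congr rfl fun i _ => ?_
  have hd : Differentiable ℝ (fderiv ℝ φ) :=
    (h.fderiv_right (m := 1) (natCast_le_infty 2)).differentiable one_ne_zero
  rw [iteratedFDeriv_two_apply, fderiv_clm_apply (hd x) (differentiableAt_const _)]
  simp

theorem continuous_laplacian (h : ContDiff ℝ (⊤ : ℕ∞) φ) : Continuous (laplacian φ) := by
  rw [funext (laplacian_eq h)]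
  have := h.continuous_iteratedFDeriv (m := 2) (natCast_le_infty 2)
  exact continuous_finsetSum _ fun i _ =>
    (ContinuousMultilinearMap.apply ℝ (fun _ : Fin 2 => EuclideanSpace ℝ (Fin d)) ℝ
      ![EuclideanSpace.single i 1, EuclideanSpace.single i 1]).continuous.comp this

theorem abs_laplacian_le (h : ContDiff ℝ (⊤ : ℕ∞) φ) (x : EuclideanSpace ℝ (Fin d)) :
    |laplacian φ x| ≤ d * ‖iteratedFDeriv ℝ 2 φ x‖ := by
  rw [laplacian_eq h]
  refine (Finset.abs_sum_le_sum_abs _ _).trans ?_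
  refine (Finset.sum_le_sum fun i _ => (iteratedFDeriv ℝ 2 φ x).le_opNorm _).trans ?_
  simp [Fin.prod_univ_two]

theorem continuous_gradSq (h : ContDiff ℝ (⊤ : ℕ∞) φ) : Continuous (gradSq φ) := by
  unfold gradSq
  simp only [norm_gradient_eq]
  exact ((h.continuous_fderiv (by simp)).norm).pow 2

theorem abs_gradSq_eq (φ : EuclideanSpace ℝ (Fin d) → ℝ) (x : EuclideanSpace ℝ (Fin d)) :
    |gradSq φ x| = ‖iteratedFDeriv ℝ 1 φ x‖ ^ 2 := by
  rw [gradSq, norm_gradient_eq, norm_iteratedFDeriv_one, abs_of_nonneg (by positivity)]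

theorem laplacian_add (hφ : ContDiff ℝ (⊤ : ℕ∞) φ) (hψ : ContDiff ℝ (⊤ : ℕ∞) ψ)
    (x : EuclideanSpace ℝ (Fin d)) : laplacian (φ + ψ) x = laplacian φ x + laplacian ψ x := by
  have hi := natCast_le_infty 2
  have hφψ : ContDiff ℝ (⊤ : ℕ∞) (φ + ψ) := hφ.add hψ
  rw [laplacian_eq hφ, laplacian_eq hψ, laplacian_eq hφψ, ← Finset.sum_add_distrib]
  refine Finset.sum_congr rfl fun i _ => ?_
  rw [iteratedFDeriv_add_apply ((hφ.of_le hi).contDiffAt) ((hψ.of_le hi).contDiffAt)]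
  rfl

end Operators

section Pairing

variable {d : ℕ} {ν : ProbabilityMeasure (EuclideanSpace ℝ (Fin d))}
  {f g : EuclideanSpace ℝ (Fin d) → ℝ}

theorem abs_pairing_le {C : ℝ} (h : ∀ x, |f x| ≤ C) : |pairing ν f| ≤ C := by
  have := norm_integral_le_of_norm_le_const (μ := (ν : Measure (EuclideanSpace ℝ (Fin d))))
    (f := f) (ae_of_all _ h)
  simpa [pairing] using this

theorem integrable_pairing (hf : Continuous f) {C : ℝ} (h : ∀ x, |f x| ≤ C) :
    Integrable f (ν : Measure (EuclideanSpace ℝ (Fin d))) :=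
  Integrable.of_bound hf.aestronglyMeasurable C (ae_of_all _ h)

theorem continuous_pairing (hf : Continuous f) {C : ℝ} (h : ∀ x, |f x| ≤ C) :
    Continuous fun ν : ProbabilityMeasure (EuclideanSpace ℝ (Fin d)) => pairing ν f :=
  ProbabilityMeasure.continuous_integral_boundedContinuousFunction
    (BoundedContinuousFunction.ofNormedAddCommGroup f hf C h)

theorem tendsto_pairing {F : ℕ → EuclideanSpace ℝ (Fin d) → ℝ} (hF : ∀ n, Continuous (F n)) {C : ℝ}
    (hC : ∀ n x, |F n x| ≤ C) (h : ∀ x, ∀ᶠ n in atTop, F n x = f x)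
    (ν : ProbabilityMeasure (EuclideanSpace ℝ (Fin d))) :
    Tendsto (fun n => pairing ν (F n)) atTop (nhds (pairing ν f)) :=
  tendsto_integral_of_dominated_convergence (fun _ => C) (fun n => (hF n).aestronglyMeasurable)
    (integrable_const C) (fun n => ae_of_all _ (hC n))
    (ae_of_all _ fun x => tendsto_const_nhds.congr' ((h x).mono fun _ hn => hn.symm))

theorem tendsto_intervalIntegral_pairing {F : ℕ → EuclideanSpace ℝ (Fin d) → ℝ}
    (hF : ∀ n, Continuous (F n)) {C : ℝ} (hC : ∀ n x, |F n x| ≤ C)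
    (h : ∀ x, ∀ᶠ n in atTop, F n x = f x)
    {m : ℝ → ProbabilityMeasure (EuclideanSpace ℝ (Fin d))} (hm : Continuous m) (s t : ℝ) :
    Tendsto (fun n => ∫ r in s..t, pairing (m r) (F n)) atTop
      (nhds (∫ r in s..t, pairing (m r) f)) :=
  intervalIntegral.tendsto_integral_filter_of_dominated_convergence (fun _ => C)
    (Eventually.of_forall fun n =>
      ((continuous_pairing (hF n) (hC n)).comp hm).aestronglyMeasurable)
    (Eventually.of_forall fun _ => ae_of_all _ fun _ _ => abs_pairing_le (hC _))
    intervalIntegrable_const (ae_of_all _ fun r _ => tendsto_pairing hF hC h (m r))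

end Pairing

section Compensated

variable {d : ℕ} (α : ℝ) (μ0 : ProbabilityMeasure (EuclideanSpace ℝ (Fin d)))
  (m : ℝ → ProbabilityMeasure (EuclideanSpace ℝ (Fin d))) (φ : EuclideanSpace ℝ (Fin d) → ℝ)

/-- The martingale `M_t(φ)` of the martingale problem, along a path of measures. -/
def mpMart (t : ℝ) : ℝ :=
  pairing (m t) φ - pairing μ0 φ - (α / 2) * ∫ s in (0:ℝ)..t, pairing (m s) (laplacian φ)

/-- The compensated square of `M_t(φ)`, along a path of measures. -/
def mpSq (t : ℝ) : ℝ :=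
  mpMart α μ0 m φ t ^ 2 - ∫ s in (0:ℝ)..t, pairing (m s) (gradSq φ)

variable {α μ0 m φ}

theorem abs_intervalIntegral_pairing_le {f : EuclideanSpace ℝ (Fin d) → ℝ} {C T t : ℝ}
    (h : ∀ x, |f x| ≤ C) (h0 : 0 ≤ t) (ht : t ≤ T) :
    |∫ s in (0:ℝ)..t, pairing (m s) f| ≤ C * T := by
  have := intervalIntegral.norm_integral_le_of_norm_le_const (f := fun r => pairing (m r) f)
    (a := 0) (b := t) (C := C) fun r _ => abs_pairing_le h
  rw [sub_zero, abs_of_nonneg h0] at this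
  exact this.trans (mul_le_mul_of_nonneg_left ht ((abs_nonneg _).trans (h 0)))

theorem abs_mpMart_le {C T t : ℝ} (h : ∀ x, |φ x| ≤ C) (hl : ∀ x, |laplacian φ x| ≤ C)
    (h0 : 0 ≤ t) (ht : t ≤ T) : |mpMart α μ0 m φ t| ≤ C + C + |α / 2| * (C * T) := by
  refine (abs_sub _ _).trans (add_le_add ((abs_sub _ _).trans (add_le_add ?_ ?_)) ?_)
  · exact abs_pairing_le h
  · exact abs_pairing_le h
  · rw [abs_mul]
    exact mul_le_mul_of_nonneg_left (abs_intervalIntegral_pairing_le hl h0 ht) (abs_nonneg _)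

theorem abs_mpSq_le {C T t : ℝ} (h : ∀ x, |φ x| ≤ C) (hl : ∀ x, |laplacian φ x| ≤ C)
    (hg : ∀ x, |gradSq φ x| ≤ C) (h0 : 0 ≤ t) (ht : t ≤ T) :
    |mpSq α μ0 m φ t| ≤ (C + C + |α / 2| * (C * T)) ^ 2 + C * T := by
  refine (abs_sub _ _).trans (add_le_add ?_ (abs_intervalIntegral_pairing_le hg h0 ht))
  rw [abs_pow]
  exact pow_le_pow_left₀ (abs_nonneg _) (abs_mpMart_le h hl h0 ht) 2

theorem mpMart_congr {m' : ℝ → ProbabilityMeasure (EuclideanSpace ℝ (Fin d))} {t : ℝ} (h0 : 0 ≤ t)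
    (h : ∀ s ∈ Icc 0 t, m s = m' s) : mpMart α μ0 m φ t = mpMart α μ0 m' φ t := by
  unfold mpMart
  rw [h t ⟨h0, le_rfl⟩, intervalIntegral.integral_congr (g := fun s => pairing (m' s) (laplacian φ))]
  intro s hs
  rw [uIcc_of_le h0] at hs
  simp only [h s hs]

theorem mpSq_congr {m' : ℝ → ProbabilityMeasure (EuclideanSpace ℝ (Fin d))} {t : ℝ} (h0 : 0 ≤ t)
    (h : ∀ s ∈ Icc 0 t, m s = m' s) : mpSq α μ0 m φ t = mpSq α μ0 m' φ t := by
  unfold mpSq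
  rw [mpMart_congr h0 h,
    intervalIntegral.integral_congr (g := fun s => pairing (m' s) (gradSq φ))]
  intro s hs
  rw [uIcc_of_le h0] at hs
  simp only [h s hs]

end Compensated

theorem IsBddSmooth.exists_bound_operators {d : ℕ} {φ : EuclideanSpace ℝ (Fin d) → ℝ}
    (h : IsBddSmooth φ) :
    ∃ C, (∀ x, |φ x| ≤ C) ∧ (∀ x, |laplacian φ x| ≤ C) ∧ ∀ x, |gradSq φ x| ≤ C := by
  obtain ⟨C₀, h₀⟩ := h.exists_bound
  obtain ⟨C₁, h₁⟩ := h.bound 1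
  obtain ⟨C₂, h₂⟩ := h.bound 2
  refine ⟨max C₀ (max (d * C₂) (C₁ ^ 2)), fun x => (h₀ x).trans (le_max_left _ _), fun x => ?_,
    fun x => ?_⟩
  · refine (abs_laplacian_le h.contDiff x).trans (le_trans ?_ ((le_max_left _ _).trans
      (le_max_right _ _)))
    exact mul_le_mul_of_nonneg_left (h₂ x) (Nat.cast_nonneg _)
  · rw [abs_gradSq_eq]
    exact (pow_le_pow_left₀ (norm_nonneg _) (h₁ x) 2).trans ((le_max_right _ _).trans
      (le_max_right _ _))

/-- A uniform version of `IsBddSmooth.exists_approx` in terms of the operators of the martingale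
problem. -/
theorem IsBddSmooth.exists_approx_operators {d : ℕ} {φ : EuclideanSpace ℝ (Fin d) → ℝ}
    (h : IsBddSmooth φ) :
    ∃ φ' : ℕ → EuclideanSpace ℝ (Fin d) → ℝ, (∀ n, ContDiff ℝ (⊤ : ℕ∞) (φ' n)) ∧
      (∀ n, HasCompactSupport (φ' n)) ∧ (∀ x, ∀ᶠ n in atTop, φ' n =ᶠ[nhds x] φ) ∧
      ∃ C, (∀ n x, |φ' n x| ≤ C) ∧ (∀ n x, |laplacian (φ' n) x| ≤ C) ∧
        ∀ n x, |gradSq (φ' n) x| ≤ C := by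
  obtain ⟨φ', hs, hc, he, hb⟩ := h.exists_approx
  refine ⟨φ', hs, hc, he, ?_⟩
  obtain ⟨C₀, h₀⟩ := hb 0
  obtain ⟨C₁, h₁⟩ := hb 1
  obtain ⟨C₂, h₂⟩ := hb 2
  refine ⟨max C₀ (max (d * C₂) (C₁ ^ 2)), fun n x => le_trans ?_ (le_max_left _ _), fun n x => ?_,
    fun n x => ?_⟩
  · simpa using h₀ n x
  · refine (abs_laplacian_le (hs n) x).trans (le_trans ?_ ((le_max_left _ _).trans
      (le_max_right _ _)))
    exact mul_le_mul_of_nonneg_left (h₂ n x) (Nat.cast_nonneg _)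
  · rw [abs_gradSq_eq]
    exact (pow_le_pow_left₀ (norm_nonneg _) (h₁ n x) 2).trans ((le_max_right _ _).trans
      (le_max_right _ _))

/-- A solution has a modification with continuous paths started at `μ0`, for which the martingale
properties hold for all bounded smooth functions. -/
theorem IsMPSolution.exists_modification {d : ℕ} {T α : ℝ} (hT : 0 ≤ T) {Ω : Type*}
    [mΩ : MeasurableSpace Ω] {ℱ : Filtration ℝ mΩ} {P : Measure Ω} [IsProbabilityMeasure P]
    {μ0 : ProbabilityMeasure (EuclideanSpace ℝ (Fin d))}
    {μ : ℝ → Ω → ProbabilityMeasure (EuclideanSpace ℝ (Fin d))} (h : IsMPSolution d T α ℱ P μ0 μ) :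
    ∃ (𝒜 : Filtration ℝ mΩ) (μ' : ℝ → Ω → ProbabilityMeasure (EuclideanSpace ℝ (Fin d))),
      (∀ ω, Continuous fun t => μ' t ω) ∧ (∀ ω, μ' 0 ω = μ0) ∧
      (∀ t ω, μ' (max 0 (min t T)) ω = μ' t ω) ∧ (∀ t, 0 ≤ t → t ≤ T → μ t =ᵐ[P] μ' t) ∧
      ∀ φ, IsBddSmooth φ → BddMart P T 𝒜 (fun t ω => mpMart α μ0 (fun s => μ' s ω) φ t) ∧
        BddMart P T 𝒜 (fun t ω => mpSq α μ0 (fun s => μ' s ω) φ t) := by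
  classical
  obtain ⟨N, hNsub, hN, hN0⟩ := exists_measurable_superset_of_null
    (ae_iff.1 (h.init.and h.cont))
  have hgood : ∀ ω ∉ N, μ 0 ω = μ0 ∧ ContinuousOn (fun t => μ t ω) (Icc 0 T) := fun ω hω => by
    by_contra hcon
    exact hω (hNsub hcon)
  set μ' : ℝ → Ω → ProbabilityMeasure (EuclideanSpace ℝ (Fin d)) := fun t ω =>
    if ω ∈ N then μ0 else μ (max 0 (min t T)) ω with hμ'
  have hin : ∀ ω ∈ N, ∀ t, μ' t ω = μ0 := fun ω hω t => by simp [hμ', hω]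
  have hout : ∀ ω ∉ N, ∀ t, 0 ≤ t → t ≤ T → μ' t ω = μ t ω := fun ω hω t h0 ht => by
    simp [hμ', hω, h0, ht]
  have hcont : ∀ ω, Continuous fun t => μ' t ω := fun ω => by
    by_cases hω : ω ∈ N
    · simp only [hμ', hω, if_true]
      exact continuous_const
    · simp only [hμ', hω, if_false]
      exact (hgood ω hω).2.comp_continuous (by fun_prop)
        fun t => ⟨le_max_left _ _, max_le hT (min_le_right _ _)⟩
  have hcs : ∀ φ, ContDiff ℝ (⊤ : ℕ∞) φ → HasCompactSupport φ →
      BddMart P T (aeFiltration ℱ P) (fun t ω => mpMart α μ0 (fun s => μ' s ω) φ t) ∧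
        BddMart P T (aeFiltration ℱ P) (fun t ω => mpSq α μ0 (fun s => μ' s ω) φ t) := by
    intro φ hs hc
    obtain ⟨C, h1, h2, h3⟩ := (IsBddSmooth.of_hasCompactSupport hs hc).exists_bound_operators
    constructor
    · refine MartingaleOn.bddMart (h.mart φ hs hc)
        (fun t h0 ht ω => abs_mpMart_le h1 h2 h0 ht) hN hN0 (fun t h0 ht ω hω => ?_)
        (k := fun t => mpMart α μ0 (fun _ => μ0) φ t) (fun t h0 ht ω hω => ?_)
      · exact mpMart_congr h0 fun s hs => hout ω hω s hs.1 (hs.2.trans ht)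
      · exact mpMart_congr h0 fun s hs => hin ω hω s
    · refine MartingaleOn.bddMart (h.qvar φ hs hc)
        (fun t h0 ht ω => abs_mpSq_le h1 h2 h3 h0 ht) hN hN0 (fun t h0 ht ω hω => ?_)
        (k := fun t => mpSq α μ0 (fun _ => μ0) φ t) (fun t h0 ht ω hω => ?_)
      · exact mpSq_congr h0 fun s hs => hout ω hω s hs.1 (hs.2.trans ht)
      · exact mpSq_congr h0 fun s hs => hin ω hω s
  refine ⟨aeFiltration ℱ P, μ', hcont, fun ω => ?_, fun t ω => ?_, fun t h0 ht => ?_,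
    fun φ hφ => ?_⟩
  · by_cases hω : ω ∈ N
    · exact hin ω hω 0
    · rw [hout ω hω 0 le_rfl hT, (hgood ω hω).1]
  · have : max 0 (min (max 0 (min t T)) T) = max 0 (min t T) := by
      rw [min_eq_left (max_le hT (min_le_right _ _)), max_eq_right (le_max_left _ _)]
    simp only [hμ', this]
  · filter_upwards [measure_eq_zero_iff_ae_notMem.1 hN0] with ω hω
    exact (hout ω hω t h0 ht).symm
  · obtain ⟨φ', hs, hc, he, C, h1, h2, h3⟩ := hφ.exists_approx_operators
    have hlim : ∀ t, 0 ≤ t → t ≤ T → ∀ ω, Tendsto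
        (fun n => mpMart α μ0 (fun s => μ' s ω) (φ' n) t) atTop
        (nhds (mpMart α μ0 (fun s => μ' s ω) φ t)) := fun t _ _ ω => by
      have e1 : ∀ x, ∀ᶠ n in atTop, φ' n x = φ x := fun x => (he x).mono fun n hn => hn.eq_of_nhds
      have e2 : ∀ x, ∀ᶠ n in atTop, laplacian (φ' n) x = laplacian φ x := fun x =>
        (he x).mono fun n hn => laplacian_congr hn
      exact ((tendsto_pairing (fun n => (hs n).continuous) h1 e1 _).sub
        (tendsto_pairing (fun n => (hs n).continuous) h1 e1 _)).sub
        ((tendsto_intervalIntegral_pairing (fun n => continuous_laplacian (hs n)) h2 e2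
          (hcont ω) 0 t).const_mul _)
    refine ⟨BddMart.of_tendsto (fun n => (hcs (φ' n) (hs n) (hc n)).1)
      (fun n t h0 ht ω => abs_mpMart_le (h1 n) (h2 n) h0 ht) hlim,
      BddMart.of_tendsto (fun n => (hcs (φ' n) (hs n) (hc n)).2)
      (fun n t h0 ht ω => abs_mpSq_le (h1 n) (h2 n) (h3 n) h0 ht) fun t h0 ht ω => ?_⟩
    have e3 : ∀ x, ∀ᶠ n in atTop, gradSq (φ' n) x = gradSq φ x := fun x =>
      (he x).mono fun n hn => gradSq_congr hn
    exact ((hlim t h0 ht ω).pow 2).sub (tendsto_intervalIntegral_pairing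
      (fun n => continuous_gradSq (hs n)) h3 e3 (hcont ω) 0 t)

section Wave

variable {d : ℕ} (p q : EuclideanSpace ℝ (Fin d) × ℝ) (x : EuclideanSpace ℝ (Fin d))

/-- The plane wave `x ↦ cos (⟪ξ, x⟫ + θ)` of frequency `ξ = p.1` and phase `θ = p.2`. -/
def wave (p : EuclideanSpace ℝ (Fin d) × ℝ) (x : EuclideanSpace ℝ (Fin d)) : ℝ :=
  Real.cos (inner ℝ p.1 x + p.2)

theorem isBddSmooth_wave : IsBddSmooth (wave p) :=
  (IsBddSmooth.cos_add p.2).comp_clm (innerSL ℝ p.1)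

theorem abs_wave_le : |wave p x| ≤ 1 := Real.abs_cos_le_one _

theorem continuous_wave : Continuous (wave p) := (isBddSmooth_wave p).contDiff.continuous

theorem hasGradientAt_wave :
    HasGradientAt (wave p) (-Real.sin (inner ℝ p.1 x + p.2) • p.1) x := by
  rw [hasGradientAt_iff_hasFDerivAt]
  have h := (((innerSL ℝ p.1).hasFDerivAt (x := x)).add_const p.2).cos
  have e : InnerProductSpace.toDual ℝ (EuclideanSpace ℝ (Fin d))
      (-Real.sin (inner ℝ p.1 x + p.2) • p.1)
      = -Real.sin (innerSL ℝ p.1 x + p.2) • innerSL ℝ p.1 := by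
    ext v
    simp
  rw [e]
  exact h

theorem fderiv_wave_apply (v : EuclideanSpace ℝ (Fin d)) :
    fderiv ℝ (wave p) x v = -Real.sin (inner ℝ p.1 x + p.2) * inner ℝ p.1 v := by
  rw [(hasGradientAt_wave p x).hasFDerivAt.fderiv]
  simp

theorem laplacian_wave : laplacian (wave p) x = -‖p.1‖ ^ 2 * wave p x := by
  have h : ∀ i : Fin d, fderiv ℝ (fun y => fderiv ℝ (wave p) y (EuclideanSpace.single i 1)) x
      (EuclideanSpace.single i 1) = -(p.1 i ^ 2 * wave p x) := by
    intro i
    simp only [fderiv_wave_apply]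
    have h : HasFDerivAt (fun y => -Real.sin (inner ℝ p.1 y + p.2)
        * inner ℝ p.1 (EuclideanSpace.single i 1)) _ x :=
      (((innerSL ℝ p.1).hasFDerivAt (x := x)).add_const p.2).sin.neg.mul_const
        (inner ℝ p.1 (EuclideanSpace.single i 1))
    rw [h.fderiv]
    simp [wave, EuclideanSpace.inner_single_right]
    ring
  rw [laplacian, Finset.sum_congr rfl fun i _ => h i, EuclideanSpace.norm_sq_eq,
    Finset.sum_neg_distrib, ← Finset.sum_mul]
  simp

theorem gradSq_wave_add : gradSq (wave p + wave q) x - gradSq (wave p) x - gradSq (wave q) x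
    = inner ℝ p.1 q.1 * (wave (p - q) x - wave (p + q) x) := by
  have h := (hasGradientAt_wave p x).hasFDerivAt.add (hasGradientAt_wave q x).hasFDerivAt
  rw [← map_add] at h
  have h' : HasGradientAt (wave p + wave q) _ x := hasGradientAt_iff_hasFDerivAt.2 h
  rw [gradSq, gradSq, gradSq, h'.gradient, (hasGradientAt_wave p x).gradient,
    (hasGradientAt_wave q x).gradient, norm_add_sq_real, inner_smul_left, inner_smul_right]
  have e1 : inner ℝ (p - q).1 x + (p - q).2
      = (inner ℝ p.1 x + p.2) - (inner ℝ q.1 x + q.2) := by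
    rw [Prod.fst_sub, Prod.snd_sub, inner_sub_left]
    ring
  have e2 : inner ℝ (p + q).1 x + (p + q).2
      = (inner ℝ p.1 x + p.2) + (inner ℝ q.1 x + q.2) := by
    rw [Prod.fst_add, Prod.snd_add, inner_add_left]
    ring
  rw [wave, wave, e1, e2, Real.cos_sub, Real.cos_add (inner ℝ p.1 x + p.2)]
  simp only [conj_trivial]
  ring

variable (α : ℝ) (μ0 : ProbabilityMeasure (EuclideanSpace ℝ (Fin d)))
  {m : ℝ → ProbabilityMeasure (EuclideanSpace ℝ (Fin d))} (t : ℝ)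

theorem mpMart_wave (m : ℝ → ProbabilityMeasure (EuclideanSpace ℝ (Fin d))) :
    mpMart α μ0 m (wave p) t + pairing μ0 (wave p)
      = pairing (m t) (wave p) + α * ‖p.1‖ ^ 2 / 2 * ∫ r in (0 : ℝ)..t, pairing (m r) (wave p) := by
  have h : ∀ ν, pairing ν (laplacian (wave p)) = -‖p.1‖ ^ 2 * pairing ν (wave p) := fun ν => by
    rw [pairing, pairing, ← integral_const_mul]
    simp only [laplacian_wave]
  simp only [mpMart, h, intervalIntegral.integral_const_mul]
  ring

theorem pairing_add {f g : EuclideanSpace ℝ (Fin d) → ℝ}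
    {ν : ProbabilityMeasure (EuclideanSpace ℝ (Fin d))} {C D : ℝ} (hf : Continuous f)
    (hg : Continuous g) (hC : ∀ x, |f x| ≤ C) (hD : ∀ x, |g x| ≤ D) :
    pairing ν (f + g) = pairing ν f + pairing ν g :=
  integral_add (integrable_pairing hf hC) (integrable_pairing hg hD)

theorem mpMart_add (hm : Continuous m) {φ ψ : EuclideanSpace ℝ (Fin d) → ℝ} (hφ : IsBddSmooth φ)
    (hψ : IsBddSmooth ψ) :
    mpMart α μ0 m (φ + ψ) t = mpMart α μ0 m φ t + mpMart α μ0 m ψ t := by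
  obtain ⟨C, h1, h2, -⟩ := hφ.exists_bound_operators
  obtain ⟨D, k1, k2, -⟩ := hψ.exists_bound_operators
  have e : laplacian (φ + ψ) = laplacian φ + laplacian ψ :=
    funext fun x => laplacian_add hφ.contDiff hψ.contDiff x
  have h3 := continuous_laplacian hφ.contDiff
  have k3 := continuous_laplacian hψ.contDiff
  have e' : ∀ ν, pairing ν (laplacian (φ + ψ)) = pairing ν (laplacian φ) + pairing ν (laplacian ψ) :=
    fun ν => by rw [e, pairing_add h3 k3 h2 k2]
  simp only [mpMart, e', pairing_add hφ.contDiff.continuous hψ.contDiff.continuous h1 k1]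
  have h4 : Continuous fun r => pairing (m r) (laplacian φ) := (continuous_pairing h3 h2).comp hm
  have k4 : Continuous fun r => pairing (m r) (laplacian ψ) := (continuous_pairing k3 k2).comp hm
  rw [intervalIntegral.integral_add (h4.intervalIntegrable _ _) (k4.intervalIntegrable _ _)]
  ring

theorem mpSq_wave_add (hm : Continuous m) :
    mpSq α μ0 m (wave p + wave q) t - mpSq α μ0 m (wave p) t - mpSq α μ0 m (wave q) t
      = 2 * (mpMart α μ0 m (wave p) t * mpMart α μ0 m (wave q) t
        - ∫ r in (0 : ℝ)..t, inner ℝ p.1 q.1 / 2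
          * (pairing (m r) (wave (p - q)) - pairing (m r) (wave (p + q)))) := by
  have hp := isBddSmooth_wave p
  have hq := isBddSmooth_wave q
  have hpq := hp.add hq
  obtain ⟨C, -, -, h1⟩ := hp.exists_bound_operators
  obtain ⟨D, -, -, h2⟩ := hq.exists_bound_operators
  obtain ⟨B, -, -, h3⟩ := hpq.exists_bound_operators
  have c1 := continuous_gradSq hp.contDiff
  have c2 := continuous_gradSq hq.contDiff
  have c3 := continuous_gradSq hpq.contDiff
  have e : ∀ ν, pairing ν (gradSq (wave p + wave q)) - pairing ν (gradSq (wave p))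
      - pairing ν (gradSq (wave q))
      = 2 * (inner ℝ p.1 q.1 / 2 * (pairing ν (wave (p - q)) - pairing ν (wave (p + q)))) := by
    intro ν
    have i1 := integrable_pairing (ν := ν) c1 h1
    have i2 := integrable_pairing (ν := ν) c2 h2
    have i3 := integrable_pairing (ν := ν) c3 h3
    have i4 := integrable_pairing (ν := ν) (continuous_wave (p - q)) (abs_wave_le (p - q))
    have i5 := integrable_pairing (ν := ν) (continuous_wave (p + q)) (abs_wave_le (p + q))
    simp only [pairing]
    rw [← integral_sub i3 i1, ← integral_sub (by exact i3.sub i1) i2, ← integral_sub i4 i5,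
      ← integral_const_mul, ← integral_const_mul]
    refine integral_congr_ae (ae_of_all _ fun x => ?_)
    simp only [gradSq_wave_add]
    ring
  have d1 : Continuous fun r => pairing (m r) (gradSq (wave p)) := (continuous_pairing c1 h1).comp hm
  have d2 : Continuous fun r => pairing (m r) (gradSq (wave q)) := (continuous_pairing c2 h2).comp hm
  have d3 : Continuous fun r => pairing (m r) (gradSq (wave p + wave q)) :=
    (continuous_pairing c3 h3).comp hm
  have e' : (∫ r in (0 : ℝ)..t, pairing (m r) (gradSq (wave p + wave q)))
      - (∫ r in (0 : ℝ)..t, pairing (m r) (gradSq (wave p)))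
      - (∫ r in (0 : ℝ)..t, pairing (m r) (gradSq (wave q)))
      = 2 * ∫ r in (0 : ℝ)..t, inner ℝ p.1 q.1 / 2
          * (pairing (m r) (wave (p - q)) - pairing (m r) (wave (p + q))) := by
    rw [← intervalIntegral.integral_sub (d3.intervalIntegrable _ _) (d1.intervalIntegrable _ _),
      ← intervalIntegral.integral_sub (by exact (d3.sub d1).intervalIntegrable _ _)
        (d2.intervalIntegrable _ _), ← intervalIntegral.integral_const_mul]
    simp only [e]
  simp only [mpSq, mpMart_add α μ0 t hm hp hq]
  linear_combination -e'

end Wave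

theorem isDriftSystem_wave {d : ℕ} {T α : ℝ} {Ω : Type*} {mΩ : MeasurableSpace Ω} {P : Measure Ω}
    [IsProbabilityMeasure P] {μ0 : ProbabilityMeasure (EuclideanSpace ℝ (Fin d))}
    {𝒜 : Filtration ℝ mΩ} {μ : ℝ → Ω → ProbabilityMeasure (EuclideanSpace ℝ (Fin d))}
    (hc : ∀ ω, Continuous fun t => μ t ω) (hcl : ∀ t ω, μ (max 0 (min t T)) ω = μ t ω)
    (h : ∀ φ, IsBddSmooth φ → BddMart P T 𝒜 (fun t ω => mpMart α μ0 (fun s => μ s ω) φ t) ∧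
      BddMart P T 𝒜 (fun t ω => mpSq α μ0 (fun s => μ s ω) φ t)) :
    IsDriftSystem P T 𝒜 (fun p q => p - q) (fun p q => p + q)
      (fun p q : EuclideanSpace ℝ (Fin d) × ℝ => inner ℝ p.1 q.1 / 2)
      (fun p => α * ‖p.1‖ ^ 2 / 2) (fun p t ω => pairing (μ t ω) (wave p)) := by
  have hX : ∀ p ω, Continuous fun r => pairing (μ r ω) (wave p) := fun p ω =>
    (continuous_pairing (continuous_wave p) (abs_wave_le p)).comp (hc ω)
  have hM : ∀ p, BddMart P T 𝒜 fun t ω => mpMart α μ0 (fun s => μ s ω) (wave p) t := fun p =>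
    (h _ (isBddSmooth_wave p)).1
  have hg : ∀ p, BddMart P T 𝒜 fun t ω => pairing (μ t ω) (wave p)
      + α * ‖p.1‖ ^ 2 / 2 * ∫ r in (0 : ℝ)..t, pairing (μ r ω) (wave p) := by
    intro p
    have := (hM p).add (BddMart.const (pairing μ0 (wave p)))
    simpa only [mpMart_wave] using this
  refine ⟨hX, fun p r ω => by rw [hcl], fun p r ω => abs_pairing_le (abs_wave_le p),
    fun p t h0 ht => ((hg p).bddMeas t h0 ht).1, fun p => (hg p).mart,
    fun p q s t hs hst ht Z hZ => ?_⟩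
  set G : (EuclideanSpace ℝ (Fin d) × ℝ) → ℝ → Ω → ℝ := fun p t ω => pairing (μ t ω) (wave p)
    + α * ‖p.1‖ ^ 2 / 2 * ∫ r in (0 : ℝ)..t, pairing (μ r ω) (wave p) with hG
  set K : ℝ → Ω → ℝ := fun r ω => inner ℝ p.1 q.1 / 2
    * (pairing (μ r ω) (wave (p - q)) - pairing (μ r ω) (wave (p + q))) with hK
  have hB : BddMart P T 𝒜 fun t ω => G p t ω * G q t ω - ∫ r in (0 : ℝ)..t, K r ω := by
    have h1 := (h _ ((isBddSmooth_wave p).add (isBddSmooth_wave q))).2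
    have h2 := ((h _ (isBddSmooth_wave p)).2.const_mul (-1))
    have h3 := ((h _ (isBddSmooth_wave q)).2.const_mul (-1))
    have h4 := (((h1.add h2).add h3).const_mul (1 / 2)).add
      (((hM p).const_mul (pairing μ0 (wave q))).add (((hM q).const_mul (pairing μ0 (wave p))).add
        (BddMart.const (pairing μ0 (wave p) * pairing μ0 (wave q)))))
    convert h4 using 3 with t ω
    have e := mpSq_wave_add p q α μ0 t (hc ω)
    have e' : ∀ p, G p t ω = mpMart α μ0 (fun s => μ s ω) (wave p) t + pairing μ0 (wave p) :=
      fun p => (mpMart_wave p α μ0 t fun s => μ s ω).symm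
    simp only [e', hK]
    linear_combination -(1 / 2) * e
  have hGB : ∀ r, 0 ≤ r → r ≤ T → BddMeas (𝒜 r) fun ω => G p r ω * G q r ω := fun r h0 hr =>
    ((hg p).bddMeas r h0 hr).mul ((hg q).bddMeas r h0 hr)
  have hKB : ∀ r, 0 ≤ r → r ≤ T → BddMeas (𝒜 r) fun ω => ∫ u in (0 : ℝ)..r, K u ω :=
    fun r h0 hr => by simpa using (hGB r h0 hr).sub (hB.bddMeas r h0 hr)
  have hs' := hst.trans ht
  have ht0 := hs.trans hst
  have hZ' := hZ.mono (𝒜.le s)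
  have i1 := (hZ'.mul ((hGB t ht0 ht).mono (𝒜.le t))).integrable (P := P)
  have i2 := (hZ'.mul ((hGB s hs hs').mono (𝒜.le s))).integrable (P := P)
  have i3 := (hZ'.mul ((hKB t ht0 ht).mono (𝒜.le t))).integrable (P := P)
  have i4 := (hZ'.mul ((hKB s hs hs').mono (𝒜.le s))).integrable (P := P)
  have e := hB.mart s t hs hst ht Z hZ
  simp only [mul_sub (Z _)] at e
  rw [integral_sub i1 i3, integral_sub i2 i4] at e
  have hKc : ∀ ω, Continuous fun r => K r ω := fun ω =>
    continuous_const.mul ((hX _ ω).sub (hX _ ω))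
  have e2 : ∫ ω, Z ω * (∫ r in s..t, K r ω) ∂P = ∫ ω, Z ω * (∫ r in (0 : ℝ)..t, K r ω) ∂P
      - ∫ ω, Z ω * (∫ r in (0 : ℝ)..s, K r ω) ∂P := by
    rw [← integral_sub i3 i4]
    refine integral_congr_ae (ae_of_all _ fun ω => ?_)
    simp only
    rw [← mul_sub, intervalIntegral.integral_interval_sub_left
      ((hKc ω).intervalIntegrable _ _) ((hKc ω).intervalIntegrable _ _)]
  change ∫ ω, Z ω * (G p t ω * G q t ω) ∂P - ∫ ω, Z ω * (G p s ω * G q s ω) ∂P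
    = ∫ ω, Z ω * (∫ r in s..t, K r ω) ∂P
  rw [e2]
  linarith

/-- Two solutions of the martingale problem started at the same measure have the same mixed
moments of plane-wave functionals. -/
theorem integral_prod_pairing_wave_eq {d : ℕ} {T α : ℝ}
    {Ω₁ : Type*} {mΩ₁ : MeasurableSpace Ω₁} {P : Measure Ω₁} [IsProbabilityMeasure P]
    {Ω₂ : Type*} {mΩ₂ : MeasurableSpace Ω₂} {Q : Measure Ω₂} [IsProbabilityMeasure Q]
    {𝒜 : Filtration ℝ mΩ₁} {ℬ : Filtration ℝ mΩ₂}
    {μ0 : ProbabilityMeasure (EuclideanSpace ℝ (Fin d))}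
    {μ : ℝ → Ω₁ → ProbabilityMeasure (EuclideanSpace ℝ (Fin d))}
    {ν : ℝ → Ω₂ → ProbabilityMeasure (EuclideanSpace ℝ (Fin d))}
    (hμ : IsDriftSystem P T 𝒜 (fun p q => p - q) (fun p q => p + q)
      (fun p q : EuclideanSpace ℝ (Fin d) × ℝ => inner ℝ p.1 q.1 / 2)
      (fun p => α * ‖p.1‖ ^ 2 / 2) (fun p t ω => pairing (μ t ω) (wave p)))
    (hν : IsDriftSystem Q T ℬ (fun p q => p - q) (fun p q => p + q)
      (fun p q : EuclideanSpace ℝ (Fin d) × ℝ => inner ℝ p.1 q.1 / 2)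
      (fun p => α * ‖p.1‖ ^ 2 / 2) (fun p t ω => pairing (ν t ω) (wave p)))
    (hμ0 : ∀ ω, μ 0 ω = μ0) (hν0 : ∀ ω, ν 0 ω = μ0) {t : ℝ} (h0 : 0 ≤ t) (ht : t ≤ T)
    (L : List (EuclideanSpace ℝ (Fin d) × ℝ)) :
    ∫ ω, (L.map fun p => pairing (μ t ω) (wave p)).prod ∂P
      = ∫ ω, (L.map fun p => pairing (ν t ω) (wave p)).prod ∂Q := by
  have h := hμ.isMomentSystem.integral_prod_eq hν.isMomentSystem
    (y := fun p => pairing μ0 (wave p)) (fun p ω => by simp [hμ0]) (fun p ω => by simp [hν0])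
    L.length L rfl t h0 ht
  simp only [List.prod_map_mul, integral_const_mul] at h
  refine mul_left_cancel₀ (fun h => ?_) h
  obtain ⟨p, -, hp⟩ := List.mem_map.1 (List.prod_eq_zero_iff.1 h)
  exact (Real.exp_pos _).ne' hp

section WaveSuperposition

open scoped FourierTransform SchwartzMap

variable {d : ℕ}

theorem exists_eq_integral_wave {f : EuclideanSpace ℝ (Fin d) → ℝ} (hf : ContDiff ℝ (⊤ : ℕ∞) f)
    (hc : HasCompactSupport f) :
    ∃ a b : EuclideanSpace ℝ (Fin d) → ℝ, Continuous a ∧ Continuous b ∧ Integrable a ∧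
      Integrable b ∧ ∀ x, f x = ∫ ξ, (a ξ * wave ((2 * Real.pi) • ξ, 0) x
        + b ξ * wave ((2 * Real.pi) • ξ, Real.pi / 2) x) := by
  have hc' : HasCompactSupport fun x => (f x : ℂ) :=
    hc.comp_left (g := fun y : ℝ => (y : ℂ)) Complex.ofReal_zero
  let F : 𝓢(EuclideanSpace ℝ (Fin d), ℂ) :=
    hc'.toSchwartzMap (Complex.ofRealCLM.contDiff.comp hf)
  let G : 𝓢(EuclideanSpace ℝ (Fin d), ℂ) := 𝓕 F
  have hG := G.integrable (μ := volume)
  have hGc : Continuous G := G.continuous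
  refine ⟨fun ξ => (G ξ).re, fun ξ => (G ξ).im, by fun_prop, by fun_prop, hG.re, hG.im,
    fun x => ?_⟩
  have h1 : 𝓕⁻ G = F := FourierTransform.fourierInv_fourier_eq F
  have h2 : (f x : ℂ) = ∫ ξ, Complex.exp (↑(2 * Real.pi * inner ℝ ξ x) * Complex.I) • G ξ := by
    rw [← Real.fourierInv_eq', ← SchwartzMap.fourierInv_coe, h1]
    rfl
  have hi : Integrable fun ξ : EuclideanSpace ℝ (Fin d) =>
      Complex.exp (↑(2 * Real.pi * inner ℝ ξ x) * Complex.I) • G ξ :=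
    hG.bdd_mul (c := 1) (by fun_prop)
      (ae_of_all _ fun ξ => (Complex.norm_exp_ofReal_mul_I _).le)
  have h3 := congrArg Complex.re h2
  rw [Complex.ofReal_re] at h3
  rw [h3, ← RCLike.re_eq_complex_re, ← integral_re hi]
  refine integral_congr_ae (ae_of_all _ fun ξ => ?_)
  simp only [wave, real_inner_smul_left, add_zero, Real.cos_add_pi_div_two, smul_eq_mul,
    RCLike.re_eq_complex_re, Complex.mul_re, Complex.exp_ofReal_mul_I_re,
    Complex.exp_ofReal_mul_I_im]
  ring

theorem pairing_eq_integral_wave {f a b : EuclideanSpace ℝ (Fin d) → ℝ} (ha : Continuous a)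
    (hb : Continuous b) (hai : Integrable a) (hbi : Integrable b)
    (h : ∀ x, f x = ∫ ξ, (a ξ * wave ((2 * Real.pi) • ξ, 0) x
        + b ξ * wave ((2 * Real.pi) • ξ, Real.pi / 2) x))
    (ν : ProbabilityMeasure (EuclideanSpace ℝ (Fin d))) :
    pairing ν f = ∫ ξ, (a ξ * pairing ν (wave ((2 * Real.pi) • ξ, 0))
        + b ξ * pairing ν (wave ((2 * Real.pi) • ξ, Real.pi / 2))) := by
  have hw : ∀ θ : ℝ, Continuous fun z : EuclideanSpace ℝ (Fin d) × EuclideanSpace ℝ (Fin d) =>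
      wave ((2 * Real.pi) • z.2, θ) z.1 := fun θ => by
    unfold wave
    fun_prop
  have hi : ∀ {c : EuclideanSpace ℝ (Fin d) → ℝ}, Continuous c → Integrable c → ∀ θ : ℝ,
      Integrable (fun z : EuclideanSpace ℝ (Fin d) × EuclideanSpace ℝ (Fin d) =>
        c z.2 * wave ((2 * Real.pi) • z.2, θ) z.1)
        ((ν : Measure (EuclideanSpace ℝ (Fin d))).prod volume) := by
    intro c hc hci θ
    refine (hci.comp_snd (ν : Measure (EuclideanSpace ℝ (Fin d)))).mul_bdd (c := 1)
      (hw θ).aestronglyMeasurable (ae_of_all _ fun z => abs_wave_le _ _)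
  unfold pairing
  simp only [h]
  rw [integral_integral_swap (by exact (hi ha hai 0).add (hi hb hbi _))]
  refine integral_congr_ae (ae_of_all _ fun ξ => ?_)
  simp only
  rw [integral_add ((integrable_pairing (continuous_wave _) (abs_wave_le _)).const_mul _)
    ((integrable_pairing (continuous_wave _) (abs_wave_le _)).const_mul _), integral_const_mul,
    integral_const_mul]

theorem continuous_pairing_wave (ν : ProbabilityMeasure (EuclideanSpace ℝ (Fin d))) (θ : ℝ) :
    Continuous fun ξ => pairing ν (wave ((2 * Real.pi) • ξ, θ)) := by
  refine continuous_of_dominated (bound := fun _ => 1)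
    (fun ξ => (continuous_wave _).aestronglyMeasurable)
    (fun ξ => ae_of_all _ fun x => abs_wave_le _ _) (integrable_const _)
    (ae_of_all _ fun x => ?_)
  unfold wave
  fun_prop

theorem measurable_pairing_of_wave {Ω : Type*} [MeasurableSpace Ω]
    {g : Ω → ProbabilityMeasure (EuclideanSpace ℝ (Fin d))}
    (hg : ∀ p, Measurable fun ω => pairing (g ω) (wave p))
    {f : EuclideanSpace ℝ (Fin d) → ℝ} (hf : ContDiff ℝ (⊤ : ℕ∞) f) (hc : HasCompactSupport f) :
    Measurable fun ω => pairing (g ω) f := by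
  obtain ⟨a, b, ha, hb, hai, hbi, h⟩ := exists_eq_integral_wave hf hc
  simp only [pairing_eq_integral_wave ha hb hai hbi h]
  have hm : ∀ θ, Measurable fun z : Ω × EuclideanSpace ℝ (Fin d) =>
      pairing (g z.1) (wave ((2 * Real.pi) • z.2, θ)) := fun θ =>
    (measurable_uncurry_of_continuous_of_measurable
      (u := fun ξ ω => pairing (g ω) (wave ((2 * Real.pi) • ξ, θ)))
      (fun ω => continuous_pairing_wave (g ω) θ) fun ξ => hg _).comp measurable_swap
  have hmeas : Measurable fun z : Ω × EuclideanSpace ℝ (Fin d) =>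
      a z.2 * pairing (g z.1) (wave ((2 * Real.pi) • z.2, 0))
        + b z.2 * pairing (g z.1) (wave ((2 * Real.pi) • z.2, Real.pi / 2)) :=
    ((ha.measurable.comp measurable_snd).mul (hm _)).add
      ((hb.measurable.comp measurable_snd).mul (hm _))
  exact (hmeas.stronglyMeasurable.integral_prod_right).measurable

end WaveSuperposition

section Inducing

variable {d : ℕ}

theorem ofReal_pairing_le {ν : ProbabilityMeasure (EuclideanSpace ℝ (Fin d))}
    {f : EuclideanSpace ℝ (Fin d) → ℝ} (hf : Continuous f) {U : Set (EuclideanSpace ℝ (Fin d))}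
    (hU : MeasurableSet U) (h0 : ∀ x, 0 ≤ f x) (h1 : ∀ x, f x ≤ 1) (hs : ∀ x ∉ U, f x = 0) :
    ENNReal.ofReal (pairing ν f) ≤ (ν : Measure (EuclideanSpace ℝ (Fin d))) U := by
  rw [pairing, ofReal_integral_eq_lintegral_ofReal (integrable_pairing hf (C := 1) fun x => by
    rw [abs_of_nonneg (h0 x)]; exact h1 x) (ae_of_all _ h0), ← lintegral_indicator_one hU]
  refine lintegral_mono fun x => ?_
  by_cases hx : x ∈ U
  · simpa [hx] using h1 x
  · simp [hx, hs x hx]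

/-- The indicator of a bounded open set is a limit of smooth compactly supported functions. -/
theorem exists_smooth_tendsto_indicator {U : Set (EuclideanSpace ℝ (Fin d))} (hU : IsOpen U)
    (hb : Bornology.IsBounded U) :
    ∃ f : ℕ → EuclideanSpace ℝ (Fin d) → ℝ, (∀ k, ContDiff ℝ (⊤ : ℕ∞) (f k)) ∧
      (∀ k, HasCompactSupport (f k)) ∧ (∀ k x, 0 ≤ f k x) ∧ (∀ k x, f k x ≤ 1) ∧
      (∀ k, ∀ x ∉ U, f k x = 0) ∧
      ∀ x, Tendsto (fun k => f k x) atTop (nhds (U.indicator 1 x)) := by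
  obtain ⟨g, hg, hgd, hgr⟩ := hU.exists_contDiff_support_eq (n := ⊤)
  have hgI : ∀ x, g x ∈ Icc (0 : ℝ) 1 := fun x => hgr (mem_range_self x)
  have hz : ∀ k, ∀ x ∉ U, 1 - (1 - g x) ^ k = 0 := by
    intro k x hx
    rw [← hg, Function.notMem_support] at hx
    simp [hx]
  refine ⟨fun k x => 1 - (1 - g x) ^ k, fun k => contDiff_const.sub ((contDiff_const.sub hgd).pow k),
    fun k => ?_, fun k x => ?_, fun k x => ?_, hz, fun x => ?_⟩
  · refine HasCompactSupport.intro (K := closure U) hb.isCompact_closure fun x hx => ?_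
    exact hz k x fun h => hx (subset_closure h)
  · exact sub_nonneg.2 (pow_le_one₀ (by linarith [(hgI x).2]) (by linarith [(hgI x).1]))
  · have : 0 ≤ (1 - g x) ^ k := pow_nonneg (by linarith [(hgI x).2]) k
    linarith
  · by_cases hx : x ∈ U
    · have hpos : 0 < g x := lt_of_le_of_ne (hgI x).1 (by
        rw [← hg] at hx
        exact (Function.mem_support.1 hx).symm)
      have := tendsto_pow_atTop_nhds_zero_of_lt_one (r := 1 - g x) (by linarith [(hgI x).2])
        (by linarith)
      simpa [hx] using this.const_sub 1
    · simp only [hz _ x hx, hx, not_false_eq_true, indicator_of_notMem, tendsto_const_nhds_iff]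

/-- The open sets of a countable family which is directed in every open set. -/
def boundedOpen (i : Finset (TopologicalSpace.countableBasis (EuclideanSpace ℝ (Fin d))) × ℕ) :
    Set (EuclideanSpace ℝ (Fin d)) :=
  (⋃ u ∈ i.1, (u : Set (EuclideanSpace ℝ (Fin d)))) ∩ Metric.ball 0 i.2

theorem isOpen_boundedOpen
    (i : Finset (TopologicalSpace.countableBasis (EuclideanSpace ℝ (Fin d))) × ℕ) :
    IsOpen (boundedOpen i) :=
  (isOpen_biUnion fun u _ => TopologicalSpace.isOpen_of_mem_countableBasis u.2).inter
    Metric.isOpen_ball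

theorem isBounded_boundedOpen
    (i : Finset (TopologicalSpace.countableBasis (EuclideanSpace ℝ (Fin d))) × ℕ) :
    Bornology.IsBounded (boundedOpen i) :=
  Metric.isBounded_ball.subset inter_subset_right

theorem measure_le_of_boundedOpen {ν : Measure (EuclideanSpace ℝ (Fin d))}
    {G : Set (EuclideanSpace ℝ (Fin d))} (hG : IsOpen G) {c : ℝ≥0∞}
    (h : ∀ i, boundedOpen i ⊆ G → ν (boundedOpen i) ≤ c) : ν G ≤ c := by
  classical
  have hsub : G ⊆ ⋃ i : {i : Finset (TopologicalSpace.countableBasis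
      (EuclideanSpace ℝ (Fin d))) × ℕ // (⋃ u ∈ i.1, (u : Set (EuclideanSpace ℝ (Fin d)))) ⊆ G},
      boundedOpen i.1 := by
    intro x hx
    obtain ⟨u, hu, hxu, huG⟩ :=
      (TopologicalSpace.isBasis_countableBasis _).exists_subset_of_mem_open hx hG
    obtain ⟨n, hn⟩ := exists_nat_gt ‖x‖
    exact mem_iUnion.2 ⟨⟨({⟨u, hu⟩}, n), by simpa using huG⟩, by
      simpa [boundedOpen] using ⟨hxu, hn⟩⟩
  refine (measure_mono hsub).trans ?_
  rw [Directed.measure_iUnion]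
  · exact iSup_le fun i => h _ (inter_subset_left.trans i.2)
  · rintro ⟨⟨s, m⟩, hi⟩ ⟨⟨t, n⟩, hj⟩
    refine ⟨⟨(s ∪ t, max m n), ?_⟩, ?_, ?_⟩
    · simp only [iUnion_subset_iff] at hi hj ⊢
      intro u hu
      exact (Finset.mem_union.1 hu).elim (hi u) (hj u)
    · exact inter_subset_inter (biUnion_subset_biUnion_left fun u hu => Finset.mem_union_left _ hu)
        (Metric.ball_subset_ball (by simp))
    · exact inter_subset_inter (biUnion_subset_biUnion_left fun u hu => Finset.mem_union_right _ hu)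
        (Metric.ball_subset_ball (by simp))

/-- The weak topology on probability measures is induced by pairing with countably many smooth
compactly supported functions. -/
theorem exists_isInducing_pairing (d : ℕ) : ∃ (ι : Type) (_ : Countable ι)
    (f : ι → EuclideanSpace ℝ (Fin d) → ℝ), (∀ i, ContDiff ℝ (⊤ : ℕ∞) (f i)) ∧
      (∀ i, HasCompactSupport (f i)) ∧
      Topology.IsInducing fun (ν : ProbabilityMeasure (EuclideanSpace ℝ (Fin d))) i =>
        pairing ν (f i) := by
  choose f hfd hfc hf0 hf1 hfz hft using fun i =>
    exists_smooth_tendsto_indicator (isOpen_boundedOpen (d := d) i) (isBounded_boundedOpen i)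
  refine ⟨(Finset (TopologicalSpace.countableBasis (EuclideanSpace ℝ (Fin d))) × ℕ) × ℕ,
    inferInstance, fun i => f i.1 i.2, fun i => hfd _ _, fun i => hfc _ _, ?_⟩
  have habs : ∀ i k x, |f i k x| ≤ 1 := fun i k x => by
    rw [abs_of_nonneg (hf0 i k x)]
    exact hf1 i k x
  set Ψ : ProbabilityMeasure (EuclideanSpace ℝ (Fin d)) → _ → ℝ := fun ν
    (i : (Finset (TopologicalSpace.countableBasis (EuclideanSpace ℝ (Fin d))) × ℕ) × ℕ) =>
      pairing ν (f i.1 i.2) with hΨ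
  have hcont : Continuous Ψ := continuous_pi fun i =>
    continuous_pairing (hfd _ _).continuous (habs _ _)
  rw [Topology.isInducing_iff_nhds]
  refine fun ν => le_antisymm (hcont.tendsto ν).le_comap ?_
  have hcd : (comap Ψ (nhds (Ψ ν))).IsCountablyGenerated := inferInstance
  refine tendsto_of_forall_isOpen_le_liminf' (L := comap Ψ (nhds (Ψ ν)))
    (μs := id) fun G hG => ?_
  refine measure_le_of_boundedOpen hG fun i hi => ?_
  have hlim : Tendsto (fun k => ENNReal.ofReal (pairing ν (f i k))) atTop
      (nhds ((ν : Measure (EuclideanSpace ℝ (Fin d))) (boundedOpen i))) := by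
    have hm := (isOpen_boundedOpen i).measurableSet
    have : Tendsto (fun k => pairing ν (f i k)) atTop
        (nhds (∫ x, (boundedOpen i).indicator 1 x ∂(ν : Measure (EuclideanSpace ℝ (Fin d))))) :=
      tendsto_integral_of_dominated_convergence (fun _ => 1)
        (fun k => (hfd i k).continuous.aestronglyMeasurable) (integrable_const _)
        (fun k => ae_of_all _ (habs i k)) (ae_of_all _ (hft i))
    rw [integral_indicator_one hm] at this
    have h2 := ENNReal.tendsto_ofReal this
    rwa [ofReal_measureReal] at h2
  refine le_of_tendsto' hlim fun k => ?_
  have hk : Tendsto (fun ν' => ENNReal.ofReal (pairing ν' (f i k))) (comap Ψ (nhds (Ψ ν)))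
      (nhds (ENNReal.ofReal (pairing ν (f i k)))) :=
    ENNReal.tendsto_ofReal (((continuous_apply (i, k)).tendsto (Ψ ν)).comp tendsto_comap)
  have hne : (comap Ψ (nhds (Ψ ν))).NeBot :=
    comap_neBot_iff.2 fun s hs => ⟨ν, mem_of_mem_nhds hs⟩
  rw [← hk.liminf_eq]
  refine liminf_le_liminf (Eventually.of_forall fun ν' => ?_)
  exact (ofReal_pairing_le (hfd i k).continuous (isOpen_boundedOpen i).measurableSet (hf0 i k)
    (hf1 i k) (hfz i k)).trans (measure_mono hi)

/-- A random probability measure is Borel measurable once its pairings with plane waves are. -/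
theorem measurable_borel_of_wave {Ω : Type*} [MeasurableSpace Ω]
    {g : Ω → ProbabilityMeasure (EuclideanSpace ℝ (Fin d))}
    (hg : ∀ p, Measurable fun ω => pairing (g ω) (wave p)) :
    Measurable[_, borel (ProbabilityMeasure (EuclideanSpace ℝ (Fin d)))] g := by
  obtain ⟨ι, _, f, hf, hc, hi⟩ := exists_isInducing_pairing d
  have : borel (ProbabilityMeasure (EuclideanSpace ℝ (Fin d)))
      = MeasurableSpace.comap (fun ν i => pairing ν (f i)) MeasurableSpace.pi := by
    rw [hi.eq_induced, borel_comap, BorelSpace.measurable_eq (α := ι → ℝ)]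
  rw [this, measurable_comap_iff]
  exact measurable_pi_lambda _ fun i => measurable_pairing_of_wave hg (hf i) (hc i)

end Inducing

section Moments

open scoped BoundedContinuousFunction

/-- The coordinate functions on a cube, as bounded continuous functions. -/
def cubeCoord {J : Type*} (j : J) : (J → Icc (-1 : ℝ) 1) →ᵇ ℝ :=
  BoundedContinuousFunction.ofNormedAddCommGroup (fun x => (x j : ℝ)) (by fun_prop) 1
    fun x => abs_le.2 (x j).2

theorem list_prod_cubeCoord_apply {J : Type*} (L : List J) (x : J → Icc (-1 : ℝ) 1) :
    (L.map cubeCoord).prod x = (L.map fun j => (x j : ℝ)).prod := by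
  induction L with
  | nil => simp
  | cons a L ih =>
    rw [List.map_cons, List.prod_cons, List.map_cons, List.prod_cons, ← ih]
    rfl

/-- Mixed moments determine a probability measure on a finite-dimensional cube. -/
theorem measure_cube_ext {J : Type*} [Finite J] {P Q : Measure (J → Icc (-1 : ℝ) 1)}
    [IsProbabilityMeasure P] [IsProbabilityMeasure Q]
    (h : ∀ L : List J, ∫ x, (L.map fun j => (x j : ℝ)).prod ∂P
      = ∫ x, (L.map fun j => (x j : ℝ)).prod ∂Q) : P = Q := by
  have : Countable J := Finite.to_countable
  refine ext_of_forall_mem_subalgebra_integral_eq_of_polish (𝕜 := ℝ)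
    (A := StarAlgebra.adjoin ℝ (range (cubeCoord (J := J)))) ?_ ?_
  · intro x y hxy
    obtain ⟨j, hj⟩ := Function.ne_iff.1 hxy
    refine ⟨_, ⟨_, ⟨cubeCoord j, StarAlgebra.subset_adjoin ℝ _ (mem_range_self j), rfl⟩, rfl⟩, ?_⟩
    exact fun hxy => hj (Subtype.ext hxy)
  · intro g hg
    have hst : star (range (cubeCoord (J := J))) = range (cubeCoord (J := J)) := by
      ext f
      rw [Set.mem_star, show star f = f from BoundedContinuousFunction.ext fun x => star_trivial _]
    rw [← StarSubalgebra.mem_toSubalgebra, StarAlgebra.adjoin_toSubalgebra, hst, union_self,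
      ← Subalgebra.mem_toSubmodule, Algebra.adjoin_eq_span] at hg
    induction hg using Submodule.span_induction with
    | mem f hf =>
      obtain ⟨L, hL, rfl⟩ := Submonoid.exists_list_of_mem_closure hf
      obtain ⟨K, rfl⟩ : L ∈ range (List.map (cubeCoord (J := J))) := by
        rw [Set.range_list_map]
        exact hL
      simp only [list_prod_cubeCoord_apply, h]
    | zero => simp
    | add f g _ _ hf hg =>
      simp only [BoundedContinuousFunction.add_apply]
      rw [integral_add (f.integrable _) (g.integrable _), integral_add (f.integrable _) (g.integrable _), hf, hg]
    | smul c f _ hf => simp only [BoundedContinuousFunction.smul_apply, integral_smul, hf]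

/-- Families of random variables bounded by `1` with the same mixed moments have the same law. -/
theorem map_pi_eq_of_moments {I Ω₁ Ω₂ : Type*} {mΩ₁ : MeasurableSpace Ω₁}
    {mΩ₂ : MeasurableSpace Ω₂} {P : Measure Ω₁} [IsProbabilityMeasure P] {Q : Measure Ω₂}
    [IsProbabilityMeasure Q] {X : Ω₁ → I → ℝ} {Y : Ω₂ → I → ℝ} (hX : Measurable X)
    (hY : Measurable Y) (hX1 : ∀ ω i, |X ω i| ≤ 1) (hY1 : ∀ ω i, |Y ω i| ≤ 1)
    (h : ∀ L : List I, ∫ ω, (L.map fun i => X ω i).prod ∂P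
      = ∫ ω, (L.map fun i => Y ω i).prod ∂Q) : P.map X = Q.map Y := by
  have := Measure.isProbabilityMeasure_map (μ := P) hX.aemeasurable
  have := Measure.isProbabilityMeasure_map (μ := Q) hY.aemeasurable
  refine IsProjectiveLimit.unique (P := fun J : Finset I => (Q.map Y).map J.restrict)
    (fun J => ?_) (fun J => rfl)
  let X' : Ω₁ → J → Icc (-1 : ℝ) 1 := fun ω j => ⟨X ω j, abs_le.1 (hX1 ω j)⟩
  let Y' : Ω₂ → J → Icc (-1 : ℝ) 1 := fun ω j => ⟨Y ω j, abs_le.1 (hY1 ω j)⟩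
  have hX' : Measurable X' := measurable_pi_lambda _ fun j =>
    ((measurable_pi_apply _).comp hX).subtype_mk
  have hY' : Measurable Y' := measurable_pi_lambda _ fun j =>
    ((measurable_pi_apply _).comp hY).subtype_mk
  have := Measure.isProbabilityMeasure_map (μ := P) hX'.aemeasurable
  have := Measure.isProbabilityMeasure_map (μ := Q) hY'.aemeasurable
  have e : P.map X' = Q.map Y' := by
    refine measure_cube_ext fun L => ?_
    have hm : Measurable fun x : J → Icc (-1 : ℝ) 1 => (L.map fun j => (x j : ℝ)).prod :=
      (continuous_list_prod L fun j _ => by fun_prop).measurable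
    rw [integral_map hX'.aemeasurable hm.aestronglyMeasurable,
      integral_map hY'.aemeasurable hm.aestronglyMeasurable]
    have := h (L.map Subtype.val)
    simp only [List.map_map] at this
    exact this
  have hv : Measurable fun (x : J → Icc (-1 : ℝ) 1) j => (x j : ℝ) := by fun_prop
  have e2 := congrArg (Measure.map fun (x : J → Icc (-1 : ℝ) 1) j => (x j : ℝ)) e
  rw [Measure.map_map hv hX', Measure.map_map hv hY'] at e2
  rw [Measure.map_map (Finset.measurable_restrict J) hX]
  refine Eq.trans ?_ (Measure.map_map (Finset.measurable_restrict J) hY).symm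
  exact e2

/-- Random probability measures whose plane-wave pairings have the same mixed moments have the same
law. -/
theorem map_borel_eq_of_wave {d : ℕ} {Ω₁ Ω₂ : Type*} {mΩ₁ : MeasurableSpace Ω₁}
    {mΩ₂ : MeasurableSpace Ω₂} {P : Measure Ω₁} [IsProbabilityMeasure P] {Q : Measure Ω₂}
    [IsProbabilityMeasure Q] {g : Ω₁ → ProbabilityMeasure (EuclideanSpace ℝ (Fin d))}
    {g' : Ω₂ → ProbabilityMeasure (EuclideanSpace ℝ (Fin d))}
    (hg : ∀ p, Measurable fun ω => pairing (g ω) (wave p))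
    (hg' : ∀ p, Measurable fun ω => pairing (g' ω) (wave p))
    (h : ∀ L : List (EuclideanSpace ℝ (Fin d) × ℝ),
      ∫ ω, (L.map fun p => pairing (g ω) (wave p)).prod ∂P
        = ∫ ω, (L.map fun p => pairing (g' ω) (wave p)).prod ∂Q) :
    letI : MeasurableSpace (ProbabilityMeasure (EuclideanSpace ℝ (Fin d))) := borel _
    P.map g = Q.map g' := by
  let : MeasurableSpace (ProbabilityMeasure (EuclideanSpace ℝ (Fin d))) := borel _
  let Ψ : ProbabilityMeasure (EuclideanSpace ℝ (Fin d)) → (EuclideanSpace ℝ (Fin d) × ℝ) → ℝ :=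
    fun ν p => pairing ν (wave p)
  have hb : borel (ProbabilityMeasure (EuclideanSpace ℝ (Fin d)))
      ≤ MeasurableSpace.comap Ψ MeasurableSpace.pi := by
    have := @measurable_borel_of_wave d _ (MeasurableSpace.comap Ψ MeasurableSpace.pi) id fun p => ?_
    · exact fun s hs => this hs
    · exact @Measurable.comp _ _ _ (MeasurableSpace.comap Ψ MeasurableSpace.pi) _ _ _ _
        (measurable_pi_apply p) (comap_measurable Ψ)
  have hgm : Measurable g := measurable_borel_of_wave hg
  have hgm' : Measurable g' := measurable_borel_of_wave hg'
  have hG : Measurable fun ω p => pairing (g ω) (wave p) := measurable_pi_lambda _ hg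
  have hG' : Measurable fun ω p => pairing (g' ω) (wave p) := measurable_pi_lambda _ hg'
  have e := map_pi_eq_of_moments (P := P) (Q := Q) hG hG'
    (fun ω p => abs_pairing_le (abs_wave_le p)) (fun ω p => abs_pairing_le (abs_wave_le p)) h
  ext s hs
  obtain ⟨C, hC, rfl⟩ := hb s hs
  rw [Measure.map_apply hgm hs, Measure.map_apply hgm' hs]
  have e2 := congrArg (fun m => m C) e
  beta_reduce at e2
  rwa [Measure.map_apply hG hC, Measure.map_apply hG' hC] at e2

end Moments

/-- **Uniqueness in law for the Dean–Kawasaki martingale problem**: any two solutions of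
`(MP)^α_{μ₀}` (possibly on different probability bases) have, at each fixed time
`t ∈ [0,T]`, the same law (as random probability measures, with the Borel σ-algebra of the
topology of weak convergence); in particular their Laplace functionals agree on bounded
continuous functions. -/
theorem uniqueness_in_law
    {d : ℕ} (hd : 1 ≤ d) {T α : ℝ} (hT : 0 < T) (hα : 0 < α)
    {Ω₁ : Type*} [mΩ₁ : MeasurableSpace Ω₁] {P : Measure Ω₁} [IsProbabilityMeasure P]
    {ℱ : Filtration ℝ mΩ₁}
    {Ω₂ : Type*} [mΩ₂ : MeasurableSpace Ω₂] {Q : Measure Ω₂} [IsProbabilityMeasure Q]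
    {𝒢 : Filtration ℝ mΩ₂}
    {μ0 : ProbabilityMeasure (EuclideanSpace ℝ (Fin d))}
    {μ : ℝ → Ω₁ → ProbabilityMeasure (EuclideanSpace ℝ (Fin d))}
    {ν : ℝ → Ω₂ → ProbabilityMeasure (EuclideanSpace ℝ (Fin d))}
    (hμ : IsMPSolution d T α ℱ P μ0 μ) (hν : IsMPSolution d T α 𝒢 Q μ0 ν)
    {t : ℝ} (ht0 : 0 ≤ t) (htT : t ≤ T) :
    (letI : MeasurableSpace (ProbabilityMeasure (EuclideanSpace ℝ (Fin d))) := borel _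
     P.map (fun ω => μ t ω) = Q.map (fun ω => ν t ω)) ∧
    ∀ f : EuclideanSpace ℝ (Fin d) → ℝ, Continuous f → (∃ C, ∀ x, |f x| ≤ C) →
      ∫ ω, Real.exp (-(pairing (μ t ω) f)) ∂P
        = ∫ ω, Real.exp (-(pairing (ν t ω) f)) ∂Q := by
  let : MeasurableSpace (ProbabilityMeasure (EuclideanSpace ℝ (Fin d))) := borel _
  have : BorelSpace (ProbabilityMeasure (EuclideanSpace ℝ (Fin d))) := ⟨rfl⟩
  obtain ⟨𝒜, μ', hμc, hμ0, hμcl, hμe, hμm⟩ := hμ.exists_modification hT.le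
  obtain ⟨ℬ, ν', hνc, hν0, hνcl, hνe, hνm⟩ := hν.exists_modification hT.le
  have sμ := isDriftSystem_wave hμc hμcl hμm
  have sν := isDriftSystem_wave hνc hνcl hνm
  have mμ : ∀ p, Measurable fun ω => pairing (μ' t ω) (wave p) := fun p =>
    ((sμ.measurable p ht0 htT).mono (𝒜.le t)).measurable
  have mν : ∀ p, Measurable fun ω => pairing (ν' t ω) (wave p) := fun p =>
    ((sν.measurable p ht0 htT).mono (ℬ.le t)).measurable
  have law : P.map (μ' t) = Q.map (ν' t) := map_borel_eq_of_wave mμ mν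
    (integral_prod_pairing_wave_eq sμ sν hμ0 hν0 ht0 htT)
  refine ⟨(Measure.map_congr (hμe t ht0 htT)).trans
    (law.trans (Measure.map_congr (hνe t ht0 htT)).symm), fun f hf hC => ?_⟩
  obtain ⟨C, hC⟩ := hC
  have hcont : Continuous fun m : ProbabilityMeasure (EuclideanSpace ℝ (Fin d)) =>
      Real.exp (-(pairing m f)) := Real.continuous_exp.comp (continuous_pairing hf hC).neg
  have hsm (m : Measure (ProbabilityMeasure (EuclideanSpace ℝ (Fin d)))) :
      AEStronglyMeasurable (fun m => Real.exp (-(pairing m f))) m :=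
    hcont.measurable.aestronglyMeasurable
  calc ∫ ω, Real.exp (-(pairing (μ t ω) f)) ∂P
      = ∫ ω, Real.exp (-(pairing (μ' t ω) f)) ∂P :=
        integral_congr_ae ((hμe t ht0 htT).fun_comp fun m => Real.exp (-(pairing m f)))
    _ = ∫ m, Real.exp (-(pairing m f)) ∂(P.map (μ' t)) :=
        (integral_map (measurable_borel_of_wave mμ).aemeasurable (hsm _)).symm
    _ = ∫ m, Real.exp (-(pairing m f)) ∂(Q.map (ν' t)) := by rw [law]
    _ = ∫ ω, Real.exp (-(pairing (ν' t ω) f)) ∂Q :=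
        integral_map (measurable_borel_of_wave mν).aemeasurable (hsm _)
    _ = ∫ ω, Real.exp (-(pairing (ν t ω) f)) ∂Q :=
        integral_congr_ae ((hνe t ht0 htT).symm.fun_comp fun m => Real.exp (-(pairing m f)))

end
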